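/- arXiv:2602.10836 — 3 statements merged into one kernel-verified Lean document; each statement's English description precedes it below -/
import Mathlib

section
/- Define the gyromotion ρ_ω(t) := (b(x_ω(t)) × v_ω(t))/(ω |B(x_ω(t))|) and the guiding centre R_ω(t) := x_ω(t) − ρ_ω(t). Then there exist functions ε_ω : ℝ → ℝ and δ_ω : ℝ → ℝ³ converging to 0 locally uniformly on ℝ as ω → ∞, and remainders r_ω : ℝ → ℝ³ with ω·r_ω → 0 locally uniformly as ω → ∞, such that for all t ∈ ℝ: R_ω(t) = x₀ + ∫₀ᵗ (h(s) + ε_ω(s)) b(R_ω(s)) ds + (1/ω)[ (v₀ × b(x₀))/|B(x₀)| + ∫₀ᵗ (b(R_ω(s))/|B(R_ω(s))|) × ( μ₀ ∇|B|(R_ω(s)) + h(s)² κ(R_ω(s)) + δ_ω(s) ) ds ] + r_ω(t). -/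
open MeasureTheory Filter RealInnerProductSpace

noncomputable section

abbrev E3 := EuclideanSpace ℝ (Fin 3)

/-- Cross product on `E3`. -/
def cross (u v : E3) : E3 :=
  !₂[u 1 * v 2 - u 2 * v 1, u 2 * v 0 - u 0 * v 2, u 0 * v 1 - u 1 * v 0]

/-- Partial derivative of `f` in the `i`-th coordinate direction. -/
def pd (f : E3 → E3) (i : Fin 3) (x : E3) : E3 := fderiv ℝ f x (EuclideanSpace.single i 1)

/-- Curl of a vector field. -/
def curl (f : E3 → E3) (x : E3) : E3 :=
  !₂[pd f 1 x 2 - pd f 2 x 1, pd f 2 x 0 - pd f 0 x 2, pd f 0 x 1 - pd f 1 x 0]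

/-- Divergence of a vector field. -/
def divergence (f : E3 → E3) (x : E3) : ℝ := ∑ i, pd f i x i
/-- Convergence in $C^{0,\alpha}_{loc}$ as $\omega\to\infty$: for every compact
$K\subset\mathbb{R}$ the $\alpha$-Hölder norm of $f_\omega - g$ on $K$ tends to $0$
(both the sup part and the Hölder seminorm part become arbitrarily small). -/
def HolderLocConv {E : Type*} [NormedAddCommGroup E] (f : ℝ → ℝ → E) (g : ℝ → E)
    (α : ℝ) : Prop :=
  ∀ K : Set ℝ, IsCompact K → ∀ ε > 0, ∃ W : ℝ, ∀ ω ≥ W,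
    (∀ t ∈ K, ‖f ω t - g t‖ ≤ ε) ∧
    ∀ s ∈ K, ∀ t ∈ K, ‖(f ω s - g s) - (f ω t - g t)‖ ≤ ε * |s - t| ^ α
/-- The cross product as a continuous bilinear map. -/
def crossL : E3 →L[ℝ] E3 →L[ℝ] E3 :=
  LinearMap.toContinuousBilinearMap (LinearMap.mk₂ ℝ cross
    (by intros; ext i; fin_cases i <;> simp [cross] <;> ring)
    (by intros; ext i; fin_cases i <;> simp [cross] <;> ring)
    (by intros; ext i; fin_cases i <;> simp [cross] <;> ring)
    (by intros; ext i; fin_cases i <;> simp [cross] <;> ring))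

lemma crossL_apply (u v : E3) : crossL u v = cross u v := rfl

lemma e3_decomp (w : E3) : w = w 0 • EuclideanSpace.single 0 1 + w 1 • EuclideanSpace.single 1 1
    + w 2 • EuclideanSpace.single 2 (1:ℝ) := by
  ext i; fin_cases i <;> simp

lemma inner_e3 (u v : E3) : inner ℝ u v =
    (u 0 : ℝ) * (v 0 : ℝ) + (u 1 : ℝ) * (v 1 : ℝ) + (u 2 : ℝ) * (v 2 : ℝ) := by
  simp [PiLp.inner_apply, Fin.sum_univ_three]; ring

/-- The sum of a bilinear form over an orthogonal frame `w, w × b, ‖w‖ b` is `‖w‖²` times its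
trace. -/
lemma bilin_frame_trace {F : Type*} [NormedAddCommGroup F] [NormedSpace ℝ F]
    (Q : E3 →L[ℝ] E3 →L[ℝ] F) (b w : E3) (hb : inner ℝ b b = 1) (hw : inner ℝ w b = 0) :
    Q w w + Q (cross w b) (cross w b) + (inner ℝ w w) • Q b b
      = (inner ℝ w w) • ∑ i, Q (EuclideanSpace.single i 1) (EuclideanSpace.single i 1) := by
  have key : ∀ i j : Fin 3, w i * w j + cross w b i * cross w b j + (inner ℝ w w) * (b i * b j)
      = if i = j then inner ℝ w w else 0 := by
    rw [inner_e3] at hb hw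
    intro i j
    rw [inner_e3]
    fin_cases i <;> fin_cases j <;> simp [cross]
    · linear_combination (w 1 ^ 2 + w 2 ^ 2) * hb + (w 0 * b 0 - w 1 * b 1 - w 2 * b 2) * hw
    · linear_combination -(w 0 * w 1) * hb + (w 0 * b 1 + w 1 * b 0) * hw
    · linear_combination -(w 0 * w 2) * hb + (w 0 * b 2 + w 2 * b 0) * hw
    · linear_combination -(w 1 * w 0) * hb + (w 1 * b 0 + w 0 * b 1) * hw
    · linear_combination (w 0 ^ 2 + w 2 ^ 2) * hb + (w 1 * b 1 - w 0 * b 0 - w 2 * b 2) * hw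
    · linear_combination -(w 1 * w 2) * hb + (w 1 * b 2 + w 2 * b 1) * hw
    · linear_combination -(w 2 * w 0) * hb + (w 2 * b 0 + w 0 * b 2) * hw
    · linear_combination -(w 2 * w 1) * hb + (w 2 * b 1 + w 1 * b 2) * hw
    · linear_combination (w 0 ^ 2 + w 1 ^ 2) * hb + (w 2 * b 2 - w 0 * b 0 - w 1 * b 1) * hw
  have ex : ∀ z : E3, Q z z = ∑ i, ∑ j, (z i * z j) •
      Q (EuclideanSpace.single i 1) (EuclideanSpace.single j 1) := by
    intro z
    conv_lhs => rw [e3_decomp z]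
    simp only [map_add, map_smul, add_apply, smul_apply,
      Fin.sum_univ_three]
    module
  rw [ex w, ex (cross w b), ex b]
  simp only [Finset.smul_sum, ← Finset.sum_add_distrib, smul_smul, ← add_smul, key]
  simp

lemma cross_smul_left (a : ℝ) (u v : E3) : cross (a • u) v = a • cross u v := by
  ext i; fin_cases i <;> simp [cross] <;> ring

lemma cross_smul_right (a : ℝ) (u v : E3) : cross u (a • v) = a • cross u v := by
  ext i; fin_cases i <;> simp [cross] <;> ring

lemma cross_add_left (u u' v : E3) : cross (u + u') v = cross u v + cross u' v := by
  ext i; fin_cases i <;> simp [cross] <;> ring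

lemma cross_add_right (u v v' : E3) : cross u (v + v') = cross u v + cross u v' := by
  ext i; fin_cases i <;> simp [cross] <;> ring

lemma cross_sub_left (u u' v : E3) : cross (u - u') v = cross u v - cross u' v := by
  ext i; fin_cases i <;> simp [cross] <;> ring

lemma cross_sub_right (u v v' : E3) : cross u (v - v') = cross u v - cross u v' := by
  ext i; fin_cases i <;> simp [cross] <;> ring

lemma e3cross_self (u : E3) : cross u u = 0 := by
  ext i; fin_cases i <;> simp [cross] <;> ring

lemma e3cross_anticomm (u v : E3) : cross u v = -cross v u := by
  ext i; fin_cases i <;> simp [cross] <;> ring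

lemma inner_cross_self_left (u v : E3) : inner ℝ u (cross u v) = 0 := by
  rw [inner_e3]; simp [cross]; ring

lemma inner_cross_self_right (u v : E3) : inner ℝ v (cross u v) = 0 := by
  rw [inner_e3]; simp [cross]; ring

lemma cross_cross_left (u v w : E3) :
    cross (cross u v) w = inner ℝ u w • v - inner ℝ v w • u := by
  ext i; rw [inner_e3, inner_e3]; fin_cases i <;> simp [cross] <;> ring

lemma cross_cross_right (u v w : E3) :
    cross u (cross v w) = inner ℝ u w • v - inner ℝ u v • w := by
  ext i; rw [inner_e3, inner_e3]; fin_cases i <;> simp [cross] <;> ring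

lemma clm_apply_coord (A : E3 →L[ℝ] E3) (z : E3) (i : Fin 3) :
    A z i = z 0 * A (EuclideanSpace.single 0 1) i + z 1 * A (EuclideanSpace.single 1 1) i
      + z 2 * A (EuclideanSpace.single 2 1) i := by
  conv_lhs => rw [e3_decomp z]
  simp

/-- Decomposition of the antisymmetric part of `A` along and across a unit vector `b`. -/
lemma cross_trace_identity (A : E3 →L[ℝ] E3) (b g : E3) (hb : inner ℝ b b = 1)
    (hg : ∀ i, g i = inner ℝ b (A (EuclideanSpace.single i 1))) :
    -(∑ i, cross (A (EuclideanSpace.single i 1)) (EuclideanSpace.single i 1))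
      + (2 : ℝ) • cross b g + cross (A b) b
      = cross b g
        - (inner ℝ b (∑ i, cross (A (EuclideanSpace.single i 1)) (EuclideanSpace.single i 1))) • b := by
  have h0 := hg 0
  have h1 := hg 1
  have h2 := hg 2
  rw [inner_e3] at hb h0 h1 h2
  ext k
  rw [inner_e3]
  simp only [Fin.sum_univ_three]
  fin_cases k <;> simp [cross, clm_apply_coord A b, h0, h1, h2] <;>
  generalize (A (EuclideanSpace.single 0 1)).ofLp = a0 <;>
  generalize (A (EuclideanSpace.single 1 1)).ofLp = a1 <;>
  generalize (A (EuclideanSpace.single 2 1)).ofLp = a2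
  · linear_combination (a2 1 - a1 2) * hb
  · linear_combination (a0 2 - a2 0) * hb
  · linear_combination (a1 0 - a0 1) * hb

/-- The unit field `b = B / |B|`. -/
def unitField (B : E3 → E3) (y : E3) : E3 := ‖B y‖⁻¹ • B y

/-- The field `B / |B|²`. -/
def recipField (B : E3 → E3) (y : E3) : E3 := (‖B y‖ ^ 2)⁻¹ • B y

section Fields

variable {B : E3 → E3}

lemma inner_unitField_self (hne : ∀ y, B y ≠ 0) (y : E3) :
    inner ℝ (unitField B y) (unitField B y) = 1 := by
  have := norm_ne_zero_iff.2 (hne y)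
  simp only [unitField, inner_smul_left, inner_smul_right, real_inner_self_eq_norm_sq]
  simp; field_simp

lemma norm_unitField (hne : ∀ y, B y ≠ 0) (y : E3) : ‖unitField B y‖ = 1 := by
  have := inner_unitField_self hne y
  rw [real_inner_self_eq_norm_sq] at this
  nlinarith [norm_nonneg (unitField B y)]

lemma smul_unitField (hne : ∀ y, B y ≠ 0) (y : E3) : ‖B y‖ • unitField B y = B y := by
  have := norm_ne_zero_iff.2 (hne y)
  simp [unitField, smul_smul, this]

lemma recipField_eq (y : E3) : recipField B y = ‖B y‖⁻¹ • unitField B y := by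
  simp [recipField, unitField, smul_smul, sq]

lemma hasFDerivAt_norm_field (hB : ContDiff ℝ 2 B) (hne : ∀ y, B y ≠ 0) (y : E3) :
    HasFDerivAt (fun y => ‖B y‖) ((innerSL ℝ (unitField B y)).comp (fderiv ℝ B y)) y := by
  have hd : HasFDerivAt B (fderiv ℝ B y) y := (hB.differentiable (by norm_num) y).hasFDerivAt
  have h1 := (hd.norm_sq).sqrt (by simpa using hne y)
  have hN := norm_ne_zero_iff.2 (hne y)
  simp only [Real.sqrt_sq (norm_nonneg _)] at h1
  refine h1.congr_fderiv ?_
  ext z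
  simp only [unitField, map_smul, ContinuousLinearMap.comp_apply, smul_apply,
    innerSL_apply_apply, smul_eq_mul, nsmul_eq_mul]
  field_simp
  norm_num

lemma hasFDerivAt_unitField (hB : ContDiff ℝ 2 B) (hne : ∀ y, B y ≠ 0) (y : E3) :
    HasFDerivAt (unitField B) (‖B y‖⁻¹ • (fderiv ℝ B y -
      ((innerSL ℝ (unitField B y)).comp (fderiv ℝ B y)).smulRight (unitField B y))) y := by
  have hd : HasFDerivAt B (fderiv ℝ B y) y := (hB.differentiable (by norm_num) y).hasFDerivAt
  have hN := norm_ne_zero_iff.2 (hne y)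
  have h1 := (((hasDerivAt_inv hN).comp_hasFDerivAt y (hasFDerivAt_norm_field hB hne y))).smul hd
  refine (show HasFDerivAt (unitField B) _ y from h1).congr_fderiv ?_
  ext1 z
  simp only [add_apply, smul_apply, sub_apply, ContinuousLinearMap.smulRight_apply,
    ContinuousLinearMap.comp_apply, innerSL_apply_apply, Function.comp_apply, smul_eq_mul]
  generalize inner ℝ (unitField B y) (fderiv ℝ B y z) = c
  simp only [unitField]
  match_scalars <;> field_simp

lemma fderiv_unitField (hB : ContDiff ℝ 2 B) (hne : ∀ y, B y ≠ 0) (y z : E3) :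
    fderiv ℝ (unitField B) y z = ‖B y‖⁻¹ • (fderiv ℝ B y z -
      (inner ℝ (unitField B y) (fderiv ℝ B y z)) • (unitField B y)) := by
  rw [(hasFDerivAt_unitField hB hne y).fderiv]; simp

lemma fderiv_recipField (hB : ContDiff ℝ 2 B) (hne : ∀ y, B y ≠ 0) (y z : E3) :
    fderiv ℝ (recipField B) y z = (‖B y‖ ^ 2)⁻¹ • (fderiv ℝ B y z -
      (2 * inner ℝ (unitField B y) (fderiv ℝ B y z)) • (unitField B y)) := by
  have hN := norm_ne_zero_iff.2 (hne y)
  have h1 := ((hasDerivAt_inv hN).comp_hasFDerivAt y (hasFDerivAt_norm_field hB hne y)).smul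
    (hasFDerivAt_unitField hB hne y)
  have h2 : recipField B = ((fun r => r⁻¹) ∘ fun y => ‖B y‖) • unitField B :=
    funext recipField_eq
  rw [h2, h1.fderiv]
  simp [smul_smul, smul_sub]
  match_scalars <;> field_simp
  ring

lemma gradient_norm_apply (hB : ContDiff ℝ 2 B) (hne : ∀ y, B y ≠ 0) (y z : E3) :
    inner ℝ (gradient (fun y => ‖B y‖) y) z = inner ℝ (unitField B y) (fderiv ℝ B y z) := by
  rw [gradient, InnerProductSpace.toDual_symm_apply, (hasFDerivAt_norm_field hB hne y).fderiv]
  simp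

lemma gradient_norm_coord (hB : ContDiff ℝ 2 B) (hne : ∀ y, B y ≠ 0) (y : E3) (i : Fin 3) :
    gradient (fun y => ‖B y‖) y i
      = inner ℝ (unitField B y) (fderiv ℝ B y (EuclideanSpace.single i 1)) := by
  rw [← gradient_norm_apply hB hne, EuclideanSpace.inner_single_right]; simp

end Fields

section PhaseSpace

/-- Parallel velocity. -/
def parV (B : E3 → E3) (z : E3 × E3) : ℝ := inner ℝ (unitField B z.1) z.2

/-- Perpendicular velocity. -/
def perpV (B : E3 → E3) (z : E3 × E3) : E3 := z.2 - parV B z • unitField B z.1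

/-- Rotated perpendicular velocity. -/
def gyroV (B : E3 → E3) (z : E3 × E3) : E3 := cross z.2 (unitField B z.1)

/-- Magnetic moment. -/
def moment (B : E3 → E3) (z : E3 × E3) : ℝ := (‖z.2‖ ^ 2 - parV B z ^ 2) / (2 * ‖B z.1‖)

/-- Grad-B drift per unit magnetic moment. -/
def gradDrift (B : E3 → E3) (y : E3) : E3 :=
  cross (‖B y‖⁻¹ • unitField B y) (gradient (fun y => ‖B y‖) y)

/-- Curvature drift per unit squared parallel velocity. -/
def curvDrift (B : E3 → E3) (y : E3) : E3 :=
  cross (‖B y‖⁻¹ • unitField B y) (fderiv ℝ (unitField B) y (unitField B y))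

/-- Parallel first-order drift per unit magnetic moment. -/
def parDrift (B : E3 → E3) (y : E3) : ℝ :=
  -(‖B y‖⁻¹ * inner ℝ (unitField B y)
    (∑ i, cross (fderiv ℝ B y (EuclideanSpace.single i 1)) (EuclideanSpace.single i 1)))

/-- First-order velocity of the guiding centre, before averaging over the gyrophase. -/
def rawDrift (B : E3 → E3) (z : E3 × E3) : E3 :=
  parV B z • fderiv ℝ (unitField B) z.1 (cross (recipField B z.1) z.2)
    - cross (fderiv ℝ (recipField B) z.1 z.2) z.2

/-- First-order velocity of the guiding centre, averaged over the gyrophase. -/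
def meanDrift (B : E3 → E3) (z : E3 × E3) : E3 :=
  (moment B z * parDrift B z.1) • unitField B z.1 + moment B z • gradDrift B z.1
    + parV B z ^ 2 • curvDrift B z.1

/-- The part of `rawDrift` that is linear in the perpendicular velocity `x`. -/
def linDrift (B : E3 → E3) (z : E3 × E3) (x : E3) : E3 :=
  parV B z • fderiv ℝ (unitField B) z.1 (cross (recipField B z.1) x)
    - parV B z • (cross (fderiv ℝ (recipField B) z.1 x) (unitField B z.1)
      + cross (fderiv ℝ (recipField B) z.1 (unitField B z.1)) x)

/-- A primitive of `rawDrift - meanDrift` along the gyration. -/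
def driftPrimitive (B : E3 → E3) (z : E3 × E3) : E3 :=
  (2 * ‖B z.1‖)⁻¹ • cross (fderiv ℝ (recipField B) z.1 (perpV B z)) (gyroV B z)
    - ‖B z.1‖⁻¹ • linDrift B z (gyroV B z)

/-- Rate of change of the magnetic moment. -/
def momentRate (B : E3 → E3) (z : E3 × E3) : ℝ :=
  -((‖B z.1‖ ^ 2)⁻¹ * (parV B z ^ 2 * inner ℝ (perpV B z) (fderiv ℝ B z.1 (unitField B z.1))
    + ((‖z.2‖ ^ 2 - parV B z ^ 2) / 2) * inner ℝ (unitField B z.1) (fderiv ℝ B z.1 (perpV B z))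
    + parV B z * (inner ℝ (perpV B z) (fderiv ℝ B z.1 (perpV B z))
      + ((‖z.2‖ ^ 2 - parV B z ^ 2) / 2)
        * inner ℝ (unitField B z.1) (fderiv ℝ B z.1 (unitField B z.1)))))

/-- A primitive of `momentRate` along the gyration. -/
def momentPrimitive (B : E3 → E3) (z : E3 × E3) : ℝ :=
  (‖B z.1‖ ^ 3)⁻¹ * (parV B z ^ 2 * inner ℝ (gyroV B z) (fderiv ℝ B z.1 (unitField B z.1))
    + ((‖z.2‖ ^ 2 - parV B z ^ 2) / 2) * inner ℝ (unitField B z.1) (fderiv ℝ B z.1 (gyroV B z))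
    + parV B z / 2 * inner ℝ (perpV B z) (fderiv ℝ B z.1 (gyroV B z)))

variable {B : E3 → E3}

lemma perpV_inner_unitField (hne : ∀ y, B y ≠ 0) (z : E3 × E3) :
    inner ℝ (perpV B z) (unitField B z.1) = 0 := by
  rw [perpV, inner_sub_left, inner_smul_left, inner_unitField_self hne, parV, real_inner_comm]
  simp

lemma perpV_inner_self (hne : ∀ y, B y ≠ 0) (z : E3 × E3) :
    inner ℝ (perpV B z) (perpV B z) = ‖z.2‖ ^ 2 - parV B z ^ 2 := by
  have h := perpV_inner_unitField hne z
  nth_rw 2 [perpV]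
  rw [inner_sub_right, inner_smul_right, h, perpV, inner_sub_left, inner_smul_left,
    real_inner_self_eq_norm_sq, ← parV]
  simp; ring

lemma gyroV_eq_cross_perpV (z : E3 × E3) : gyroV B z = cross (perpV B z) (unitField B z.1) := by
  rw [perpV, cross_sub_left, cross_smul_left, e3cross_self, gyroV]; simp

lemma cross_field (hne : ∀ y, B y ≠ 0) (y v : E3) :
    cross v (B y) = ‖B y‖ • gyroV B (y, v) := by
  rw [gyroV, ← cross_smul_right, smul_unitField hne]

lemma parV_gyration (hne : ∀ y, B y ≠ 0) (y v : E3) (s : ℝ) :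
    parV B (y, v + s • cross v (B y)) = parV B (y, v) := by
  rw [cross_field hne]
  simp [parV, gyroV, inner_add_right, inner_smul_right, inner_cross_self_right]

lemma perpV_gyration (hne : ∀ y, B y ≠ 0) (y v : E3) (s : ℝ) :
    perpV B (y, v + s • cross v (B y)) = perpV B (y, v) + (s * ‖B y‖) • gyroV B (y, v) := by
  rw [perpV, parV_gyration hne, cross_field hne, perpV, smul_smul]
  simp; abel

lemma gyroV_gyration (hne : ∀ y, B y ≠ 0) (y v : E3) (s : ℝ) :
    gyroV B (y, v + s • cross v (B y)) = gyroV B (y, v) - (s * ‖B y‖) • perpV B (y, v) := by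
  rw [cross_field hne, gyroV, cross_add_left, smul_smul, cross_smul_left]
  simp only [gyroV, perpV, parV]
  rw [cross_cross_left, inner_unitField_self hne, real_inner_comm v]
  module

lemma hasDerivAt_quadratic {F : Type*} [NormedAddCommGroup F] [NormedSpace ℝ F] (a b c : F) :
    HasDerivAt (fun s : ℝ => a + s • b + s ^ 2 • c) b 0 := by
  have h1 : HasDerivAt (fun s : ℝ => s • b) ((1 : ℝ) • b) 0 := (hasDerivAt_id (0 : ℝ)).smul_const b
  have h2 : HasDerivAt (fun s : ℝ => s ^ 2 • c) ((2 * (0 : ℝ) ^ 1 * 1) • c) 0 :=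
    (((hasDerivAt_id (0 : ℝ)).pow 2).congr_deriv (by simp)).smul_const c
  exact ((h1.const_add a).add h2).congr_deriv (by simp)

lemma hasDerivAt_norm_sq_gyration (u v : E3) :
    HasDerivAt (fun s : ℝ => ‖v + s • cross v u‖ ^ 2) 0 0 := by
  have := hasDerivAt_quadratic (‖v‖ ^ 2) 0 (‖cross v u‖ ^ 2)
  refine this.congr_of_eventuallyEq (Eventually.of_forall fun s => ?_)
  simp only [norm_add_sq_real, inner_smul_right, inner_cross_self_left, norm_smul, smul_eq_mul,
    mul_pow, Real.norm_eq_abs, sq_abs]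
  ring

lemma hasDerivAt_moment_gyration (hne : ∀ y, B y ≠ 0) (y v : E3) :
    HasDerivAt (fun s : ℝ => moment B (y, v + s • cross v (B y))) 0 0 := by
  simp only [moment, parV_gyration hne]
  exact (((hasDerivAt_norm_sq_gyration (B y) v).sub_const _).div_const _).congr_deriv (by simp)

lemma rawDrift_eq (z : E3 × E3) :
    rawDrift B z = linDrift B z (perpV B z)
      - cross (fderiv ℝ (recipField B) z.1 (perpV B z)) (perpV B z)
      - parV B z ^ 2 • cross (fderiv ℝ (recipField B) z.1 (unitField B z.1)) (unitField B z.1) := by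
  have h : z.2 = perpV B z + parV B z • unitField B z.1 := by simp [perpV]
  have h2 : cross (recipField B z.1) z.2 = cross (recipField B z.1) (perpV B z) := by
    conv_lhs => rw [h]
    rw [cross_add_right, recipField_eq, cross_smul_right, cross_smul_left ‖B z.1‖⁻¹ _ (unitField B z.1),
      e3cross_self]
    simp
  rw [rawDrift, linDrift, h2]
  conv_lhs => rw [h]
  simp only [map_add, map_smul, cross_add_left, cross_add_right, cross_smul_left, cross_smul_right]
  module

lemma curvDrift_eq (hB : ContDiff ℝ 2 B) (hne : ∀ y, B y ≠ 0) (y : E3) :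
    -cross (fderiv ℝ (recipField B) y (unitField B y)) (unitField B y) = curvDrift B y := by
  rw [curvDrift, fderiv_recipField hB hne, fderiv_unitField hB hne]
  simp only [cross_smul_left, cross_smul_right, cross_sub_left, cross_sub_right, e3cross_self]
  rw [e3cross_anticomm (unitField B y)]
  have := norm_ne_zero_iff.2 (hne y)
  match_scalars
  field_simp

lemma gradDrift_eq (hB : ContDiff ℝ 2 B) (hne : ∀ y, B y ≠ 0) (y : E3) :
    ‖B y‖ • (cross (fderiv ℝ (recipField B) y (unitField B y)) (unitField B y)
      - ∑ i, cross (fderiv ℝ (recipField B) y (EuclideanSpace.single i 1)) (EuclideanSpace.single i 1))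
      = parDrift B y • unitField B y + gradDrift B y := by
  have key := cross_trace_identity (fderiv ℝ B y) (unitField B y) (gradient (fun y => ‖B y‖) y)
    (inner_unitField_self hne y) (gradient_norm_coord hB hne y)
  have hg : cross (unitField B y) (gradient (fun y => ‖B y‖) y)
      = ∑ i, inner ℝ (unitField B y) (fderiv ℝ B y (EuclideanSpace.single i 1)) •
        cross (unitField B y) (EuclideanSpace.single i 1) := by
    conv_lhs => rw [e3_decomp (gradient (fun y => ‖B y‖) y)]
    simp only [gradient_norm_coord hB hne, cross_add_right, cross_smul_right, Fin.sum_univ_three]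
  have hN := norm_ne_zero_iff.2 (hne y)
  have hs : ∑ i, cross (fderiv ℝ (recipField B) y (EuclideanSpace.single i 1))
      (EuclideanSpace.single i 1) = (‖B y‖ ^ 2)⁻¹ •
        (∑ i, cross (fderiv ℝ B y (EuclideanSpace.single i 1)) (EuclideanSpace.single i 1)
          - (2 : ℝ) • cross (unitField B y) (gradient (fun y => ‖B y‖) y)) := by
    rw [hg, Finset.smul_sum, ← Finset.sum_sub_distrib, Finset.smul_sum]
    refine Finset.sum_congr rfl fun i _ => ?_
    rw [fderiv_recipField hB hne, cross_smul_left, cross_sub_left, cross_smul_left, mul_smul]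
  rw [gradDrift, parDrift, hs, fderiv_recipField hB hne]
  simp only [cross_smul_left, cross_sub_left, e3cross_self, smul_zero, sub_zero]
  generalize (∑ i, cross (fderiv ℝ B y (EuclideanSpace.single i 1)) (EuclideanSpace.single i 1))
    = S at key ⊢
  generalize cross (unitField B y) (gradient (fun y => ‖B y‖) y) = X at key ⊢
  generalize cross (fderiv ℝ B y (unitField B y)) (unitField B y) = Y at key ⊢
  generalize inner ℝ (unitField B y) S = c at key ⊢
  linear_combination (norm := skip) ‖B y‖⁻¹ • key
  match_scalars <;> field_simp <;> ring

lemma hasDerivAt_driftPrimitive (hB : ContDiff ℝ 2 B) (hne : ∀ y, B y ≠ 0) (y v : E3) :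
    HasDerivAt (fun s : ℝ => driftPrimitive B (y, v + s • cross v (B y)))
      (rawDrift B (y, v) - meanDrift B (y, v)) 0 := by
  have hN := norm_ne_zero_iff.2 (hne y)
  have tr := bilin_frame_trace (crossL.comp (fderiv ℝ (recipField B) y)) (unitField B y)
    (perpV B (y, v)) (inner_unitField_self hne y) (perpV_inner_unitField hne (y, v))
  simp only [ContinuousLinearMap.comp_apply, crossL_apply, perpV_inner_self hne] at tr
  rw [← gyroV_eq_cross_perpV (B := B) (y, v)] at tr
  have e1 : rawDrift B (y, v) - meanDrift B (y, v) =
      (2⁻¹ : ℝ) • (cross (fderiv ℝ (recipField B) y (gyroV B (y, v))) (gyroV B (y, v))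
        - cross (fderiv ℝ (recipField B) y (perpV B (y, v))) (perpV B (y, v)))
        + linDrift B (y, v) (perpV B (y, v)) := by
    have hm : moment B (y, v) * parDrift B y = moment B (y, v) • parDrift B y := rfl
    rw [rawDrift_eq, meanDrift, hm, smul_assoc, ← smul_add, ← gradDrift_eq hB hne,
      ← curvDrift_eq hB hne, moment, smul_smul]
    have h2 : (‖v‖ ^ 2 - parV B (y, v) ^ 2) / (2 * ‖B y‖) * ‖B y‖
      = 2⁻¹ * (‖v‖ ^ 2 - parV B (y, v) ^ 2) := by field_simp
    rw [h2]
    linear_combination (norm := module) (-(2⁻¹ : ℝ)) • tr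
  rw [e1]
  refine (hasDerivAt_quadratic (driftPrimitive B (y, v)) _
    (-((2 * ‖B y‖)⁻¹ * ‖B y‖ ^ 2) • cross (fderiv ℝ (recipField B) y (gyroV B (y, v)))
      (perpV B (y, v)))).congr_of_eventuallyEq (Eventually.of_forall fun s => ?_)
  simp only [driftPrimitive, linDrift, parV_gyration hne, perpV_gyration hne, gyroV_gyration hne,
    map_add, map_sub, map_smul, cross_add_left, cross_sub_left, cross_sub_right,
    cross_smul_left, cross_smul_right]
  match_scalars <;> field_simp

lemma hasDerivAt_momentPrimitive (hne : ∀ y, B y ≠ 0)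
    (hdiv : ∀ y, divergence B y = 0) (y v : E3) :
    HasDerivAt (fun s : ℝ => momentPrimitive B (y, v + s • cross v (B y)))
      (momentRate B (y, v)) 0 := by
  have hN := norm_ne_zero_iff.2 (hne y)
  have tr := bilin_frame_trace ((innerSL ℝ).flip.comp (fderiv ℝ B y)) (unitField B y)
    (perpV B (y, v)) (inner_unitField_self hne y) (perpV_inner_unitField hne (y, v))
  have ht : ∑ i, inner ℝ (EuclideanSpace.single i (1:ℝ)) (fderiv ℝ B y (EuclideanSpace.single i 1))
      = 0 := by
    rw [← hdiv y]; simp [divergence, pd, EuclideanSpace.inner_single_left]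
  simp only [ContinuousLinearMap.comp_apply, ContinuousLinearMap.flip_apply, innerSL_apply_apply,
    perpV_inner_self hne, ht] at tr
  rw [← gyroV_eq_cross_perpV (B := B) (y, v)] at tr
  have hlin : ∀ p q : ℝ, HasDerivAt (fun s : ℝ => p - s * ‖B y‖ * q) (-(‖B y‖ * q)) 0 := fun p q =>
    (hasDerivAt_quadratic p (-(‖B y‖ * q)) 0).congr_of_eventuallyEq
      (Eventually.of_forall fun s => by simp; ring)
  have hquad := hasDerivAt_quadratic (inner ℝ (perpV B (y, v)) (fderiv ℝ B y (gyroV B (y, v))))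
    (‖B y‖ * (inner ℝ (gyroV B (y, v)) (fderiv ℝ B y (gyroV B (y, v)))
      - inner ℝ (perpV B (y, v)) (fderiv ℝ B y (perpV B (y, v)))))
    (-(‖B y‖ ^ 2 * inner ℝ (gyroV B (y, v)) (fderiv ℝ B y (perpV B (y, v)))))
  have hE := ((hasDerivAt_norm_sq_gyration (B y) v).sub_const (parV B (y, v) ^ 2)).div_const 2
  have h1 := (hlin (inner ℝ (gyroV B (y, v)) (fderiv ℝ B y (unitField B y)))
    (inner ℝ (perpV B (y, v)) (fderiv ℝ B y (unitField B y)))).const_mul (parV B (y, v) ^ 2)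
  have h2 := hE.mul (hlin (inner ℝ (unitField B y) (fderiv ℝ B y (gyroV B (y, v))))
    (inner ℝ (unitField B y) (fderiv ℝ B y (perpV B (y, v)))))
  have h3 := hquad.const_mul (parV B (y, v) / 2)
  refine ((((h1.add h2).add h3).const_mul (‖B y‖ ^ 3)⁻¹).congr_deriv ?_).congr_of_eventuallyEq
    (Eventually.of_forall fun s => ?_)
  · simp only [momentRate]
    simp at tr ⊢
    field_simp
    linear_combination parV B (y, v) * tr
  · simp only [momentPrimitive, parV_gyration hne, perpV_gyration hne, gyroV_gyration hne,
      map_sub, map_smul, inner_add_left, inner_sub_left, inner_smul_left, inner_sub_right,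
      inner_smul_right, Pi.add_apply, Pi.mul_apply]
    simp only [conj_trivial, smul_eq_mul]
    ring

lemma hasDerivAt_moment_line (hB : ContDiff ℝ 2 B) (hne : ∀ y, B y ≠ 0) (y v : E3) :
    HasDerivAt (fun s : ℝ => moment B (y + s • v, v)) (momentRate B (y, v)) 0 := by
  have hN := norm_ne_zero_iff.2 (hne y)
  have hl : HasDerivAt (fun s : ℝ => y + s • v) v 0 :=
    (((hasDerivAt_id (0:ℝ)).smul_const v).const_add y).congr_deriv (by simp)
  have hl0 : y + (0:ℝ) • v = y := by simp
  have hNd : HasDerivAt (fun s : ℝ => ‖B (y + s • v)‖)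
      (inner ℝ (unitField B y) (fderiv ℝ B y v)) 0 := by
    have := hasFDerivAt_norm_field hB hne (y + (0:ℝ) • v)
    refine (this.comp_hasDerivAt (0:ℝ) hl).congr_deriv ?_
    rw [hl0]; rfl
  have hbd : HasDerivAt (fun s : ℝ => unitField B (y + s • v)) (fderiv ℝ (unitField B) y v) 0 := by
    have := hasFDerivAt_unitField hB hne (y + (0:ℝ) • v)
    refine (this.comp_hasDerivAt (0:ℝ) hl).congr_deriv ?_
    rw [← this.fderiv, hl0]
  have hu : HasDerivAt (fun s : ℝ => parV B (y + s • v, v))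
      (inner ℝ (fderiv ℝ (unitField B) y v) v) 0 :=
    (hbd.inner ℝ (hasDerivAt_const (0:ℝ) v)).congr_deriv (by simp)
  have h := ((hu.pow 2).const_sub (‖v‖ ^ 2)).div (hNd.const_mul 2) (by simpa using hne y)
  refine h.congr_deriv ?_
  simp only [hl0, fderiv_unitField hB hne]
  have hv : v = perpV B (y, v) + parV B (y, v) • unitField B y := by simp [perpV]
  have e0 : inner ℝ (unitField B y) v = parV B (y, v) := rfl
  have e1 : inner ℝ (fderiv ℝ B y v) v = inner ℝ (perpV B (y, v)) (fderiv ℝ B y v)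
      + parV B (y, v) * inner ℝ (unitField B y) (fderiv ℝ B y v) := by
    nth_rw 2 [hv]
    rw [inner_add_right, inner_smul_right, real_inner_comm, real_inner_comm (unitField B y)]
  have e2 : fderiv ℝ B y v = fderiv ℝ B y (perpV B (y, v))
      + parV B (y, v) • fderiv ℝ B y (unitField B y) := by
    conv_lhs => rw [hv]
    simp
  rw [inner_smul_left, inner_sub_left, e1, inner_smul_left, e0, e2]
  simp only [momentRate, inner_add_right, inner_smul_right]
  simp
  field_simp
  ring

end PhaseSpace

section Regularity

variable {B : E3 → E3}

lemma ContDiff.e3cross {F : Type*} [NormedAddCommGroup F] [NormedSpace ℝ F] {n : WithTop ℕ∞}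
    {f g : F → E3} (hf : ContDiff ℝ n f) (hg : ContDiff ℝ n g) :
    ContDiff ℝ n fun z => cross (f z) (g z) :=
  (crossL.contDiff.comp hf).clm_apply hg

lemma contDiff_norm_field (hB : ContDiff ℝ 2 B) (hne : ∀ y, B y ≠ 0) :
    ContDiff ℝ 2 fun y => ‖B y‖ :=
  hB.norm ℝ hne

lemma contDiff_norm_field_inv (hB : ContDiff ℝ 2 B) (hne : ∀ y, B y ≠ 0) :
    ContDiff ℝ 2 fun y => ‖B y‖⁻¹ :=
  (contDiff_norm_field hB hne).inv fun y => norm_ne_zero_iff.2 (hne y)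

lemma contDiff_unitField (hB : ContDiff ℝ 2 B) (hne : ∀ y, B y ≠ 0) :
    ContDiff ℝ 2 (unitField B) :=
  (contDiff_norm_field_inv hB hne).smul hB

lemma contDiff_recipField (hB : ContDiff ℝ 2 B) (hne : ∀ y, B y ≠ 0) :
    ContDiff ℝ 2 (recipField B) := by
  rw [show recipField B = fun y => ‖B y‖⁻¹ • unitField B y from funext recipField_eq]
  exact (contDiff_norm_field_inv hB hne).smul (contDiff_unitField hB hne)

lemma contDiff_fderiv_two {f : E3 → E3} (hf : ContDiff ℝ 2 f) : ContDiff ℝ 1 (fderiv ℝ f) :=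
  hf.fderiv_right (by norm_num)

lemma contDiff_gradient_norm (hB : ContDiff ℝ 2 B) (hne : ∀ y, B y ≠ 0) :
    ContDiff ℝ 1 (gradient fun y => ‖B y‖) := by
  have h : gradient (fun y => ‖B y‖) = fun y =>
      (InnerProductSpace.toDual ℝ E3).symm (fderiv ℝ (fun y => ‖B y‖) y) := rfl
  rw [h]
  exact (InnerProductSpace.toDual ℝ E3).symm.contDiff.comp
    ((contDiff_norm_field hB hne).fderiv_right (m := 1) (by norm_num))

lemma contDiff_curvature (hB : ContDiff ℝ 2 B) (hne : ∀ y, B y ≠ 0) :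
    ContDiff ℝ 1 fun y => fderiv ℝ (unitField B) y (unitField B y) :=
  (contDiff_fderiv_two (contDiff_unitField hB hne)).clm_apply
    ((contDiff_unitField hB hne).of_le (by norm_num))

lemma contDiff_gradDrift (hB : ContDiff ℝ 2 B) (hne : ∀ y, B y ≠ 0) :
    ContDiff ℝ 1 (gradDrift B) :=
  (((contDiff_norm_field_inv hB hne).smul (contDiff_unitField hB hne)).of_le
    (by norm_num)).e3cross (contDiff_gradient_norm hB hne)

lemma contDiff_curvDrift (hB : ContDiff ℝ 2 B) (hne : ∀ y, B y ≠ 0) :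
    ContDiff ℝ 1 (curvDrift B) :=
  (((contDiff_norm_field_inv hB hne).smul (contDiff_unitField hB hne)).of_le
    (by norm_num)).e3cross (contDiff_curvature hB hne)

lemma contDiff_parDrift (hB : ContDiff ℝ 2 B) (hne : ∀ y, B y ≠ 0) :
    ContDiff ℝ 1 (parDrift B) := by
  refine (((contDiff_norm_field_inv hB hne).of_le (by norm_num)).mul
    (((contDiff_unitField hB hne).of_le (by norm_num)).inner ℝ ?_)).neg
  exact ContDiff.sum fun i _ =>
    ((contDiff_fderiv_two hB).clm_apply contDiff_const).e3cross contDiff_const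

lemma contDiff_parV (hB : ContDiff ℝ 2 B) (hne : ∀ y, B y ≠ 0) : ContDiff ℝ 1 (parV B) :=
  (((contDiff_unitField hB hne).of_le (by norm_num)).comp contDiff_fst).inner ℝ contDiff_snd

lemma contDiff_perpV (hB : ContDiff ℝ 2 B) (hne : ∀ y, B y ≠ 0) : ContDiff ℝ 1 (perpV B) :=
  contDiff_snd.sub ((contDiff_parV hB hne).smul
    (((contDiff_unitField hB hne).of_le (by norm_num)).comp contDiff_fst))

lemma contDiff_gyroV (hB : ContDiff ℝ 2 B) (hne : ∀ y, B y ≠ 0) : ContDiff ℝ 1 (gyroV B) :=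
  contDiff_snd.e3cross (((contDiff_unitField hB hne).of_le (by norm_num)).comp contDiff_fst)

lemma contDiff_moment (hB : ContDiff ℝ 2 B) (hne : ∀ y, B y ≠ 0) : ContDiff ℝ 1 (moment B) := by
  refine ((contDiff_snd.norm_sq ℝ).sub ((contDiff_parV hB hne).pow 2)).div
    (contDiff_const.mul (((contDiff_norm_field hB hne).of_le (by norm_num)).comp contDiff_fst))
    fun z => ?_
  simpa using hne z.1

lemma contDiff_driftPrimitive (hB : ContDiff ℝ 2 B) (hne : ∀ y, B y ≠ 0) :
    ContDiff ℝ 1 (driftPrimitive B) := by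
  have hN : ContDiff ℝ 1 fun z : E3 × E3 => ‖B z.1‖⁻¹ :=
    ((contDiff_norm_field_inv hB hne).of_le (by norm_num)).comp contDiff_fst
  have hb : ContDiff ℝ 1 fun z : E3 × E3 => unitField B z.1 :=
    ((contDiff_unitField hB hne).of_le (by norm_num)).comp contDiff_fst
  have hr : ContDiff ℝ 1 fun z : E3 × E3 => recipField B z.1 :=
    ((contDiff_recipField hB hne).of_le (by norm_num)).comp contDiff_fst
  have hDb : ContDiff ℝ 1 fun z : E3 × E3 => fderiv ℝ (unitField B) z.1 :=
    (contDiff_fderiv_two (contDiff_unitField hB hne)).comp contDiff_fst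
  have hDr : ContDiff ℝ 1 fun z : E3 × E3 => fderiv ℝ (recipField B) z.1 :=
    (contDiff_fderiv_two (contDiff_recipField hB hne)).comp contDiff_fst
  have hu := contDiff_parV hB hne
  have hw := contDiff_perpV hB hne
  have hg := contDiff_gyroV hB hne
  have h2N : ContDiff ℝ 1 fun z : E3 × E3 => (2 * ‖B z.1‖)⁻¹ := by
    simp only [mul_inv]; exact contDiff_const.mul hN
  exact (h2N.smul ((hDr.clm_apply hw).e3cross hg)).sub (hN.smul
    ((hu.smul (hDb.clm_apply (hr.e3cross hg))).sub
      (hu.smul (((hDr.clm_apply hg).e3cross hb).add ((hDr.clm_apply hb).e3cross hg)))))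

lemma contDiff_momentPrimitive (hB : ContDiff ℝ 2 B) (hne : ∀ y, B y ≠ 0) :
    ContDiff ℝ 1 (momentPrimitive B) := by
  have hN : ContDiff ℝ 1 fun z : E3 × E3 => (‖B z.1‖ ^ 3)⁻¹ := by
    simp only [← inv_pow]
    exact (((contDiff_norm_field_inv hB hne).of_le (by norm_num)).comp contDiff_fst).pow 3
  have hb : ContDiff ℝ 1 fun z : E3 × E3 => unitField B z.1 :=
    ((contDiff_unitField hB hne).of_le (by norm_num)).comp contDiff_fst
  have hD : ContDiff ℝ 1 fun z : E3 × E3 => fderiv ℝ B z.1 :=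
    (contDiff_fderiv_two hB).comp contDiff_fst
  have hu := contDiff_parV hB hne
  have hw := contDiff_perpV hB hne
  have hg := contDiff_gyroV hB hne
  have hE : ContDiff ℝ 1 fun z : E3 × E3 => (‖z.2‖ ^ 2 - parV B z ^ 2) / 2 :=
    ((contDiff_snd.norm_sq ℝ).sub (hu.pow 2)).div_const 2
  exact hN.mul ((((hu.pow 2).mul (hg.inner ℝ (hD.clm_apply hb))).add
    (hE.mul (hb.inner ℝ (hD.clm_apply hg)))).add
    ((hu.div_const 2).mul (hw.inner ℝ (hD.clm_apply hg))))

end Regularity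

section Trajectory

/-- The pair `(q, p)` is the solution of the normalized Lorentz equation with parameter `ω`. -/
structure IsLorentzTrajectory (B : E3 → E3) (ω : ℝ) (x₀ v₀ : E3) (q p : ℝ → E3) : Prop where
  hasDerivAt_pos : ∀ t, HasDerivAt q (p t) t
  hasDerivAt_vel : ∀ t, HasDerivAt p (ω • cross (p t) (B (q t))) t
  pos_zero : q 0 = x₀
  vel_zero : p 0 = v₀

/-- A compact region of phase space containing every trajectory up to time `T`. -/
def phaseBox (x₀ v₀ : E3) (T : ℝ) : Set (E3 × E3) :=
  Metric.closedBall x₀ (‖v₀‖ * T) ×ˢ Metric.closedBall 0 ‖v₀‖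

lemma exists_bound_phaseBox {F : Type*} [NormedAddCommGroup F] {g : E3 × E3 → F}
    (hg : Continuous g) (x₀ v₀ : E3) (T : ℝ) :
    ∃ C, 0 ≤ C ∧ ∀ z ∈ phaseBox x₀ v₀ T, ‖g z‖ ≤ C := by
  obtain ⟨C, hC⟩ := ((isCompact_closedBall x₀ (‖v₀‖ * T)).prod
    (isCompact_closedBall (0 : E3) ‖v₀‖)).exists_bound_of_continuousOn hg.continuousOn
  exact ⟨max C 0, le_max_right _ _, fun z hz => (hC z hz).trans (le_max_left _ _)⟩

variable {B : E3 → E3} {ω : ℝ} {x₀ v₀ : E3} {q p : ℝ → E3}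
  {F : Type*} [NormedAddCommGroup F] [NormedSpace ℝ F]

namespace IsLorentzTrajectory

lemma norm_vel (hq : IsLorentzTrajectory B ω x₀ v₀ q p) (t : ℝ) : ‖p t‖ = ‖v₀‖ := by
  have hd : ∀ s, HasDerivAt (fun s => ‖p s‖ ^ 2) 0 s := fun s =>
    (hq.hasDerivAt_vel s).norm_sq.congr_deriv (by
      simp [inner_smul_right, inner_cross_self_left])
  have h := is_const_of_deriv_eq_zero (fun s => (hd s).differentiableAt) (fun s => (hd s).deriv) t 0
  simp only [hq.vel_zero] at h
  exact (sq_eq_sq₀ (norm_nonneg _) (norm_nonneg _)).1 h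

lemma norm_pos_sub_le (hq : IsLorentzTrajectory B ω x₀ v₀ q p) (s t : ℝ) :
    ‖q t - q s‖ ≤ ‖v₀‖ * |t - s| :=
  convex_univ.norm_image_sub_le_of_norm_hasDerivWithin_le
    (fun x _ => (hq.hasDerivAt_pos x).hasDerivWithinAt) (fun x _ => (hq.norm_vel x).le)
    (Set.mem_univ s) (Set.mem_univ t)

lemma mem_phaseBox (hq : IsLorentzTrajectory B ω x₀ v₀ q p) {t T : ℝ} (ht : |t| ≤ T) :
    (q t, p t) ∈ phaseBox x₀ v₀ T := by
  refine ⟨?_, ?_⟩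
  · have h := hq.norm_pos_sub_le 0 t
    rw [hq.pos_zero, sub_zero] at h
    simpa [dist_eq_norm] using h.trans (by gcongr)
  · simp [hq.norm_vel t]

lemma continuous_phase (hq : IsLorentzTrajectory B ω x₀ v₀ q p) :
    Continuous fun t => (q t, p t) :=
  (continuous_iff_continuousAt.2 fun t => (hq.hasDerivAt_pos t).continuousAt).prodMk
    (continuous_iff_continuousAt.2 fun t => (hq.hasDerivAt_vel t).continuousAt)

lemma hasDerivAt_comp (hq : IsLorentzTrajectory B ω x₀ v₀ q p) {Φ : E3 × E3 → F}
    (hΦ : Differentiable ℝ Φ) (t : ℝ) :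
    HasDerivAt (fun t => Φ (q t, p t)) (fderiv ℝ Φ (q t, p t) (p t, 0)
      + ω • fderiv ℝ Φ (q t, p t) (0, cross (p t) (B (q t)))) t := by
  have h := (hΦ (q t, p t)).hasFDerivAt.comp_hasDerivAt t
    ((hq.hasDerivAt_pos t).prodMk (hq.hasDerivAt_vel t))
  refine h.congr_deriv ?_
  rw [← map_smul, ← map_add]
  simp

end IsLorentzTrajectory

lemma fderiv_gyration {Φ : E3 × E3 → F} (hΦ : Differentiable ℝ Φ) {g : E3 × E3 → F}
    (hg : ∀ y v, HasDerivAt (fun s : ℝ => Φ (y, v + s • cross v (B y))) (g (y, v)) 0) (z : E3 × E3) :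
    fderiv ℝ Φ z (0, cross z.2 (B z.1)) = g z := by
  have hl : HasDerivAt (fun s : ℝ => z.2 + s • cross z.2 (B z.1)) (cross z.2 (B z.1)) 0 :=
    (((hasDerivAt_id (0 : ℝ)).smul_const _).const_add _).congr_deriv (by simp)
  have h := (hΦ (z.1, z.2 + (0 : ℝ) • cross z.2 (B z.1))).hasFDerivAt.comp_hasDerivAt (0 : ℝ)
    ((hasDerivAt_const (0 : ℝ) z.1).prodMk hl)
  have := h.unique (hg z.1 z.2)
  simpa using this

lemma fderiv_line {Φ : E3 × E3 → F} (hΦ : Differentiable ℝ Φ) {g : E3 × E3 → F}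
    (hg : ∀ y v, HasDerivAt (fun s : ℝ => Φ (y + s • v, v)) (g (y, v)) 0) (z : E3 × E3) :
    fderiv ℝ Φ z (z.2, 0) = g z := by
  have hl : HasDerivAt (fun s : ℝ => z.1 + s • z.2) z.2 0 :=
    (((hasDerivAt_id (0 : ℝ)).smul_const _).const_add _).congr_deriv (by simp)
  have h := (hΦ (z.1 + (0 : ℝ) • z.2, z.2)).hasFDerivAt.comp_hasDerivAt (0 : ℝ)
    (hl.prodMk (hasDerivAt_const (0 : ℝ) z.2))
  have := h.unique (hg z.1 z.2)
  simpa using this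

lemma continuous_gyration_deriv (hBc : Continuous B) {Φ g : E3 × E3 → F} (hΦ : ContDiff ℝ 1 Φ)
    (hg : ∀ y v, HasDerivAt (fun s : ℝ => Φ (y, v + s • cross v (B y))) (g (y, v)) 0) :
    Continuous g := by
  rw [← funext (fderiv_gyration (hΦ.differentiable (by norm_num)) hg)]
  exact (hΦ.continuous_fderiv (by norm_num)).clm_apply (continuous_const.prodMk
    ((crossL.continuous.comp continuous_snd).clm_apply (hBc.comp continuous_fst)))

/-- Averaging over the gyrophase: the integral of a function with a primitive along the gyration
is of order `1 / ω`. -/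
lemma exists_averaging_bound [CompleteSpace F] (hBc : Continuous B) {Φ g : E3 × E3 → F}
    (hΦ : ContDiff ℝ 1 Φ)
    (hg : ∀ y v, HasDerivAt (fun s : ℝ => Φ (y, v + s • cross v (B y))) (g (y, v)) 0)
    (x₀ v₀ : E3) (T : ℝ) :
    ∃ C, 0 ≤ C ∧ ∀ ω > 0, ∀ q p, IsLorentzTrajectory B ω x₀ v₀ q p → ∀ t, |t| ≤ T →
      ‖∫ s in (0 : ℝ)..t, g (q s, p s)‖ ≤ C / ω := by
  have hd : Differentiable ℝ Φ := hΦ.differentiable (by norm_num)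
  have hDc : Continuous (fderiv ℝ Φ) := hΦ.continuous_fderiv (by norm_num)
  have hgeq := fderiv_gyration hd hg
  have hgc := continuous_gyration_deriv hBc hΦ hg
  have hlc : Continuous fun z : E3 × E3 => fderiv ℝ Φ z (z.2, 0) :=
    hDc.clm_apply (continuous_snd.prodMk continuous_const)
  obtain ⟨C₀, hC₀, h₀⟩ := exists_bound_phaseBox hΦ.continuous x₀ v₀ T
  obtain ⟨C₁, hC₁, h₁⟩ := exists_bound_phaseBox hlc x₀ v₀ T
  refine ⟨2 * C₀ + C₁ * |T|, by positivity, fun ω hω q p hq t ht => ?_⟩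
  have hph := hq.continuous_phase
  have hT : 0 ≤ T := (abs_nonneg t).trans ht
  have hi₁ : IntervalIntegrable (fun s => fderiv ℝ Φ (q s, p s) (p s, 0)) volume 0 t :=
    (hlc.comp hph).intervalIntegrable 0 t
  have hi₂ : IntervalIntegrable (fun s => ω • g (q s, p s)) volume 0 t :=
    ((hgc.comp hph).const_smul ω).intervalIntegrable 0 t
  have hftc : ∫ s in (0 : ℝ)..t, (fderiv ℝ Φ (q s, p s) (p s, 0) + ω • g (q s, p s))
      = Φ (q t, p t) - Φ (q 0, p 0) := by
    refine intervalIntegral.integral_eq_sub_of_hasDerivAt (f := fun s => Φ (q s, p s))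
      (fun s _ => ?_) (hi₁.add hi₂)
    exact (hq.hasDerivAt_comp hd s).congr_deriv (by rw [hgeq])
  rw [intervalIntegral.integral_add hi₁ hi₂, intervalIntegral.integral_smul] at hftc
  have hsol : ω • ∫ s in (0 : ℝ)..t, g (q s, p s) = Φ (q t, p t) - Φ (q 0, p 0)
      - ∫ s in (0 : ℝ)..t, fderiv ℝ Φ (q s, p s) (p s, 0) := by
    rw [← hftc]; simp
  have hb : ‖∫ s in (0 : ℝ)..t, fderiv ℝ Φ (q s, p s) (p s, 0)‖ ≤ C₁ * |t - 0| := by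
    refine intervalIntegral.norm_integral_le_of_norm_le_const fun s hs => h₁ _ (hq.mem_phaseBox ?_)
    have := Set.abs_sub_left_of_mem_uIcc (Set.uIoc_subset_uIcc hs)
    simp at this
    exact this.trans ht
  rw [le_div_iff₀ hω, mul_comm]
  calc ω * ‖∫ s in (0 : ℝ)..t, g (q s, p s)‖
      = ‖ω • ∫ s in (0 : ℝ)..t, g (q s, p s)‖ := by
        rw [norm_smul, Real.norm_of_nonneg hω.le]
    _ ≤ ‖Φ (q t, p t)‖ + ‖Φ (q 0, p 0)‖ + C₁ * |t - 0| := by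
        rw [hsol]
        exact (norm_sub_le _ _).trans (add_le_add (norm_sub_le _ _) hb)
    _ ≤ C₀ + C₀ + C₁ * |T| := by
        refine add_le_add (add_le_add (h₀ _ (hq.mem_phaseBox ht))
          (h₀ _ (hq.mem_phaseBox (by simpa using hT)))) (mul_le_mul_of_nonneg_left ?_ hC₁)
        rw [sub_zero]
        exact ht.trans (le_abs_self T)
    _ = 2 * C₀ + C₁ * |T| := by ring

/-- A phase-space function that is invariant along the gyration varies at unit speed. -/
lemma exists_lipschitz_bound {Φ : E3 × E3 → F} (hΦ : ContDiff ℝ 1 Φ)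
    (hg : ∀ y v, HasDerivAt (fun s : ℝ => Φ (y, v + s • cross v (B y))) 0 0)
    (x₀ v₀ : E3) (T : ℝ) :
    ∃ C, 0 ≤ C ∧ ∀ ω q p, IsLorentzTrajectory B ω x₀ v₀ q p → ∀ s t, |s| ≤ T → |t| ≤ T →
      ‖Φ (q t, p t) - Φ (q s, p s)‖ ≤ C * |t - s| := by
  have hd : Differentiable ℝ Φ := hΦ.differentiable (by norm_num)
  have hDc : Continuous (fderiv ℝ Φ) := hΦ.continuous_fderiv (by norm_num)
  have hgeq := fderiv_gyration (g := fun _ => 0) hd hg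
  have hlc : Continuous fun z : E3 × E3 => fderiv ℝ Φ z (z.2, 0) :=
    hDc.clm_apply (continuous_snd.prodMk continuous_const)
  obtain ⟨C₁, hC₁, h₁⟩ := exists_bound_phaseBox hlc x₀ v₀ T
  refine ⟨C₁, hC₁, fun ω q p hq s t hs ht => ?_⟩
  refine (convex_Icc (-T) T).norm_image_sub_le_of_norm_hasDerivWithin_le (f := fun t => Φ (q t, p t))
    (fun x _ => ((hq.hasDerivAt_comp hd x).congr_deriv
      (g' := fderiv ℝ Φ (q x, p x) (p x, 0) + ω • 0) ?_).hasDerivWithinAt)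
    (fun x hx => ?_) (abs_le.1 hs) (abs_le.1 ht)
  · rw [hgeq]
  · simpa using h₁ _ (hq.mem_phaseBox (abs_le.2 hx))

/-- The magnetic moment is an adiabatic invariant. -/
lemma exists_moment_bound (hB : ContDiff ℝ 2 B) (hne : ∀ y, B y ≠ 0)
    (hdiv : ∀ y, divergence B y = 0) (x₀ v₀ : E3) (T : ℝ) :
    ∃ C, 0 ≤ C ∧ ∀ ω > 0, ∀ q p, IsLorentzTrajectory B ω x₀ v₀ q p → ∀ t, |t| ≤ T →
      |moment B (q t, p t) - moment B (x₀, v₀)| ≤ C / ω := by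
  obtain ⟨C, hC, h⟩ := exists_averaging_bound hB.continuous (contDiff_momentPrimitive hB hne)
    (hasDerivAt_momentPrimitive hne hdiv) x₀ v₀ T
  refine ⟨C, hC, fun ω hω q p hq t ht => ?_⟩
  have hm := contDiff_moment hB hne
  have hd := hm.differentiable (by norm_num)
  have hline := fderiv_line hd (hasDerivAt_moment_line hB hne)
  have hgyr := fderiv_gyration (g := fun _ => 0) hd (hasDerivAt_moment_gyration hne)
  have hc : Continuous (momentRate B) := by
    rw [← funext hline]
    exact (hm.continuous_fderiv (by norm_num)).clm_apply (continuous_snd.prodMk continuous_const)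
  have hftc : ∫ s in (0 : ℝ)..t, momentRate B (q s, p s)
      = moment B (q t, p t) - moment B (q 0, p 0) := by
    refine intervalIntegral.integral_eq_sub_of_hasDerivAt (f := fun s => moment B (q s, p s))
      (fun s _ => ?_) ((hc.comp hq.continuous_phase).intervalIntegrable _ _)
    exact (hq.hasDerivAt_comp hd s).congr_deriv (by rw [hgyr, hline (q s, p s)]; simp)
  have := h ω hω q p hq t ht
  rwa [hftc, hq.pos_zero, hq.vel_zero] at this

end Trajectory

section LocalBounds

variable {X F : Type*} [NormedAddCommGroup X] [NormedSpace ℝ X] [ProperSpace X]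
  [NormedAddCommGroup F] [NormedSpace ℝ F]

lemma exists_lipschitz_closedBall {f : X → F} (hf : ContDiff ℝ 1 f) (c : X) (r : ℝ) :
    ∃ C, 0 ≤ C ∧ ∀ y ∈ Metric.closedBall c r, ∀ z ∈ Metric.closedBall c r,
      ‖f z - f y‖ ≤ C * ‖z - y‖ := by
  obtain ⟨C, hC⟩ := (isCompact_closedBall c r).exists_bound_of_continuousOn
    (hf.continuous_fderiv (by norm_num)).continuousOn
  refine ⟨max C 0, le_max_right _ _, fun y hy z hz => ?_⟩
  exact (convex_closedBall c r).norm_image_sub_le_of_norm_fderiv_le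
    (fun w _ => hf.differentiable (by norm_num) w)
    (fun w hw => (hC w hw).trans (le_max_left _ _)) hy hz

lemma exists_taylor_closedBall {f : X → F} (hf : ContDiff ℝ 2 f) (c : X) (r : ℝ) :
    ∃ C, 0 ≤ C ∧ ∀ y ∈ Metric.closedBall c r, ∀ z ∈ Metric.closedBall c r,
      ‖f z - f y - fderiv ℝ f y (z - y)‖ ≤ C * ‖z - y‖ ^ 2 := by
  obtain ⟨C, hC, h⟩ := exists_lipschitz_closedBall
    (hf.fderiv_right (m := 1) (by norm_num)) c r
  refine ⟨C, hC, fun y hy z hz => ?_⟩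
  have hconv := (convex_closedBall c r).inter (convex_closedBall y ‖z - y‖)
  rw [sq, ← mul_assoc]
  refine hconv.norm_image_sub_le_of_norm_hasFDerivWithin_le'
    (fun w _ => (hf.differentiable (by norm_num) w).hasFDerivAt.hasFDerivWithinAt)
    (fun w hw => (h y hy w hw.1).trans ?_) ⟨hy, by simp⟩ ⟨hz, by simp [dist_eq_norm]⟩
  gcongr
  simpa [dist_eq_norm] using hw.2

end LocalBounds

section ParallelVelocity

variable {B : E3 → E3}

lemma exists_increment_bound (hB : ContDiff ℝ 2 B) (hne : ∀ y, B y ≠ 0) (x₀ v₀ : E3) (T : ℝ) :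
    ∃ C, 0 ≤ C ∧ ∀ ω q p, IsLorentzTrajectory B ω x₀ v₀ q p → ∀ t η, |t| ≤ T → 0 ≤ η → η ≤ 1 →
      |inner ℝ (unitField B (q t)) (q (t + η) - q t) - η * parV B (q t, p t)| ≤ C * η ^ 2 := by
  obtain ⟨L, hL, hLip⟩ := exists_lipschitz_closedBall
    ((contDiff_unitField hB hne).of_le (show (1 : WithTop ℕ∞) ≤ 2 by norm_num)) x₀ (‖v₀‖ * (T + 1))
  obtain ⟨K, hK, hU⟩ := exists_lipschitz_bound (B := B) (contDiff_parV hB hne)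
    (fun y v => by simpa only [parV_gyration hne] using hasDerivAt_const (0 : ℝ) (parV B (y, v)))
    x₀ v₀ (T + 1)
  refine ⟨L * ‖v₀‖ * ‖v₀‖ + K, by positivity, fun ω q p hq t η ht hη hη1 => ?_⟩
  have hbox : ∀ s ∈ Set.Icc t (t + η), |s| ≤ T + 1 := fun s hs => by
    have := abs_le.1 ht
    exact abs_le.2 ⟨by linarith [hs.1], by linarith [hs.2]⟩
  have htm : t ∈ Set.Icc t (t + η) := ⟨le_rfl, by linarith⟩
  have hd : ∀ s, HasDerivAt
      (fun s => inner ℝ (unitField B (q t)) (q s) - (s - t) * parV B (q t, p t))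
      (inner ℝ (unitField B (q t)) (p s) - parV B (q t, p t)) s := fun s => by
    have h1 := (hasDerivAt_const s (unitField B (q t))).inner ℝ (hq.hasDerivAt_pos s)
    have h2 := ((hasDerivAt_id s).sub_const t).mul_const (parV B (q t, p t))
    exact (h1.sub h2).congr_deriv (by simp)
  have hbd : ∀ s ∈ Set.Icc t (t + η), ‖inner ℝ (unitField B (q t)) (p s) - parV B (q t, p t)‖
      ≤ (L * ‖v₀‖ * ‖v₀‖ + K) * η := fun s hs => by
    have hsη : |s - t| ≤ η := abs_le.2 ⟨by linarith [hs.1], by linarith [hs.2]⟩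
    have hst : |t - s| ≤ η := by rwa [abs_sub_comm]
    have e : inner ℝ (unitField B (q t)) (p s) - parV B (q t, p t)
        = inner ℝ (unitField B (q t) - unitField B (q s)) (p s)
          + (parV B (q s, p s) - parV B (q t, p t)) := by
      simp only [parV, inner_sub_left]; ring
    rw [e]
    have h1 : ‖inner ℝ (unitField B (q t) - unitField B (q s)) (p s)‖ ≤ L * ‖v₀‖ * ‖v₀‖ * η := by
      refine (norm_inner_le_norm _ _).trans ?_
      rw [hq.norm_vel]
      calc _ ≤ L * (‖v₀‖ * η) * ‖v₀‖ := by
            gcongr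
            refine (hLip _ (hq.mem_phaseBox (hbox s hs)).1 _ (hq.mem_phaseBox (hbox t htm)).1).trans ?_
            gcongr
            exact (hq.norm_pos_sub_le s t).trans (by gcongr)
        _ = _ := by ring
    have h2 := (hU ω q p hq t s (hbox t htm) (hbox s hs)).trans
      (mul_le_mul_of_nonneg_left hsη hK)
    refine (norm_add_le _ _).trans ?_
    linarith
  have h := (convex_Icc t (t + η)).norm_image_sub_le_of_norm_hasDerivWithin_le
    (fun s _ => (hd s).hasDerivWithinAt) hbd htm ⟨by linarith, le_rfl⟩
  rw [Real.norm_eq_abs, Real.norm_eq_abs, add_sub_cancel_left, abs_of_nonneg hη] at h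
  rw [inner_sub_right]
  calc _ = _ := by congr 1; ring
    _ ≤ _ := h
    _ = _ := by ring

/-- Convergence of the parallel velocity to that of the limiting motion. -/
lemma tendsto_parV (hB : ContDiff ℝ 2 B) (hne : ∀ y, B y ≠ 0) {x₀ v₀ : E3} {q p : ℝ → ℝ → E3}
    (hq : ∀ ω > 0, IsLorentzTrajectory B ω x₀ v₀ (q ω) (p ω)) {x : ℝ → E3} {h : ℝ → ℝ}
    (hx : ContDiff ℝ 2 x) (hxh : ∀ t, deriv x t = h t • unitField B (x t))
    (hconv : HolderLocConv q x 0) (T : ℝ) {e : ℝ} (he : 0 < e) :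
    ∃ W, ∀ ω ≥ W, ∀ t, |t| ≤ T → |parV B (q ω t, p ω t) - h t| ≤ e := by
  obtain ⟨L, hL, hLip⟩ := exists_lipschitz_closedBall
    ((contDiff_unitField hB hne).of_le (show (1 : WithTop ℕ∞) ≤ 2 by norm_num)) x₀ (‖v₀‖ * T + 1)
  obtain ⟨M, hM, hinc⟩ := exists_increment_bound hB hne x₀ v₀ T
  obtain ⟨M', hM', htay⟩ := exists_taylor_closedBall hx 0 (T + 1)
  set η : ℝ := min 1 (e / (2 * (M + M' + 1))) with hη
  have hη0 : 0 < η := by positivity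
  have hη1 : η ≤ 1 := min_le_left _ _
  have hηe : (M + M') * η ≤ e / 2 := by
    have : η ≤ e / (2 * (M + M' + 1)) := min_le_right _ _
    rw [le_div_iff₀ (by positivity)] at this
    nlinarith
  set d : ℝ := min 1 (η * e / (2 * (2 + L * (2 + ‖v₀‖)))) with hd
  have hd0 : 0 < d := by positivity
  have hd1 : d ≤ 1 := min_le_left _ _
  have hde : (2 + L * (2 + ‖v₀‖)) * d ≤ η * e / 2 := by
    have : d ≤ η * e / (2 * (2 + L * (2 + ‖v₀‖))) := min_le_right _ _
    rw [le_div_iff₀ (by positivity)] at this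
    linarith
  obtain ⟨W, hW⟩ := hconv (Metric.closedBall 0 (T + 1)) (isCompact_closedBall _ _) d hd0
  refine ⟨max W 1, fun ω hω t ht => ?_⟩
  have htraj := hq ω (lt_of_lt_of_le one_pos ((le_max_right _ _).trans hω))
  have hsup := (hW ω ((le_max_left _ _).trans hω)).1
  have ht' := abs_le.1 ht
  have m1 : t ∈ Metric.closedBall (0 : ℝ) (T + 1) := by
    rw [mem_closedBall_zero_iff, Real.norm_eq_abs]; linarith
  have m2 : t + η ∈ Metric.closedBall (0 : ℝ) (T + 1) := by
    rw [mem_closedBall_zero_iff, Real.norm_eq_abs, abs_le]; constructor <;> linarith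
  have s1 := hsup t m1
  have s2 := hsup (t + η) m2
  have hqt : q ω t ∈ Metric.closedBall x₀ (‖v₀‖ * T) := (htraj.mem_phaseBox ht).1
  have hqt' : q ω t ∈ Metric.closedBall x₀ (‖v₀‖ * T + 1) :=
    Metric.closedBall_subset_closedBall (by linarith) hqt
  have hxt : x t ∈ Metric.closedBall x₀ (‖v₀‖ * T + 1) := by
    rw [Metric.mem_closedBall] at hqt ⊢
    refine (dist_triangle_left _ _ (q ω t)).trans ?_
    rw [dist_eq_norm]
    linarith
  have a1 := hinc ω (q ω) (p ω) htraj t η ht hη0.le hη1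
  have a2 := htay t m1 (t + η) m2
  rw [add_sub_cancel_left, Real.norm_eq_abs, sq_abs, fderiv_eq_smul_deriv] at a2
  have a3 := hLip _ hxt _ hqt'
  have hinn : inner ℝ (unitField B (x t)) (deriv x t) = h t := by
    rw [hxh, inner_smul_right, inner_unitField_self hne, mul_one]
  have hdiff : ‖(q ω (t + η) - q ω t) - (x (t + η) - x t)‖ ≤ 2 * d := by
    have := norm_sub_le (q ω (t + η) - x (t + η)) (q ω t - x t)
    rw [show (q ω (t + η) - q ω t) - (x (t + η) - x t)
      = (q ω (t + η) - x (t + η)) - (q ω t - x t) by abel]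
    linarith
  have hΔq : ‖q ω (t + η) - q ω t‖ ≤ ‖v₀‖ := by
    refine (htraj.norm_pos_sub_le t (t + η)).trans ?_
    rw [add_sub_cancel_left, abs_of_pos hη0]
    exact mul_le_of_le_one_right (norm_nonneg _) hη1
  have hΔx : ‖x (t + η) - x t‖ ≤ 2 + ‖v₀‖ := by
    have := norm_sub_norm_le (x (t + η) - x t) (q ω (t + η) - q ω t)
    rw [norm_sub_rev (x (t + η) - x t)] at this
    linarith
  have e1 : η * (parV B (q ω t, p ω t) - h t)
      = -(inner ℝ (unitField B (q ω t)) (q ω (t + η) - q ω t) - η * parV B (q ω t, p ω t))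
        + inner ℝ (unitField B (q ω t)) ((q ω (t + η) - q ω t) - (x (t + η) - x t))
        + inner ℝ (unitField B (q ω t) - unitField B (x t)) (x (t + η) - x t)
        + inner ℝ (unitField B (x t)) (x (t + η) - x t - η • deriv x t) := by
    rw [inner_sub_left, inner_sub_right _ (q ω (t + η) - q ω t), inner_sub_right _ _ (η • deriv x t),
      inner_smul_right, hinn]
    ring
  have b2 : |inner ℝ (unitField B (q ω t)) ((q ω (t + η) - q ω t) - (x (t + η) - x t))| ≤ 2 * d := by
    refine (abs_real_inner_le_norm _ _).trans ?_
    rwa [norm_unitField hne, one_mul]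
  have b3 : |inner ℝ (unitField B (q ω t) - unitField B (x t)) (x (t + η) - x t)|
      ≤ L * d * (2 + ‖v₀‖) := by
    refine (abs_real_inner_le_norm _ _).trans ?_
    gcongr
    exact a3.trans (by gcongr)
  have b4 : |inner ℝ (unitField B (x t)) (x (t + η) - x t - η • deriv x t)| ≤ M' * η ^ 2 := by
    refine (abs_real_inner_le_norm _ _).trans ?_
    rwa [norm_unitField hne, one_mul]
  have hfin : η * |parV B (q ω t, p ω t) - h t| ≤ η * e := by
    rw [← abs_of_pos hη0, ← abs_mul, abs_of_pos hη0, e1]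
    refine (abs_add_le _ _).trans ?_
    refine (add_le_add_left ((abs_add_le _ _).trans (add_le_add_left (abs_add_le _ _) _)) _).trans ?_
    rw [abs_neg]
    nlinarith
  exact le_of_mul_le_mul_left hfin hη0

end ParallelVelocity

section GuidingCentre

/-- Gyroradius vector. -/
def larmor (B : E3 → E3) (ω : ℝ) (z : E3 × E3) : E3 := ω⁻¹ • cross (recipField B z.1) z.2

/-- Guiding centre. -/
def centre (B : E3 → E3) (ω : ℝ) (z : E3 × E3) : E3 := z.1 - larmor B ω z

/-- Effective velocity of the guiding centre, with fields evaluated at the guiding centre. -/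
def centreVel (B : E3 → E3) (ω : ℝ) (z : E3 × E3) : E3 :=
  (parV B z + ω⁻¹ * (moment B z * parDrift B z.1)) • unitField B (centre B ω z)
    + ω⁻¹ • (moment B z • gradDrift B (centre B ω z) + parV B z ^ 2 • curvDrift B (centre B ω z))

/-- Error made by evaluating the fields at the guiding centre. -/
def centreVelError (B : E3 → E3) (ω : ℝ) (z : E3 × E3) : E3 :=
  -(parV B z • (unitField B (centre B ω z) - unitField B z.1
      - fderiv ℝ (unitField B) z.1 (centre B ω z - z.1)))
    - ω⁻¹ • ((moment B z * parDrift B z.1) • (unitField B (centre B ω z) - unitField B z.1)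
      + moment B z • (gradDrift B (centre B ω z) - gradDrift B z.1)
      + parV B z ^ 2 • (curvDrift B (centre B ω z) - curvDrift B z.1))

variable {B : E3 → E3} {ω : ℝ} {x₀ v₀ : E3} {q p : ℝ → E3}

lemma continuous_centre (hB : ContDiff ℝ 2 B) (hne : ∀ y, B y ≠ 0) (ω : ℝ) :
    Continuous (centre B ω) :=
  continuous_fst.sub ((((crossL.continuous.comp ((contDiff_recipField hB hne).continuous.comp
    continuous_fst)).clm_apply continuous_snd)).const_smul ω⁻¹)

lemma continuous_centreVel (hB : ContDiff ℝ 2 B) (hne : ∀ y, B y ≠ 0) (ω : ℝ) :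
    Continuous (centreVel B ω) := by
  have hc := continuous_centre hB hne ω
  have hu := (contDiff_parV hB hne).continuous
  have hm := (contDiff_moment hB hne).continuous
  exact ((hu.add (continuous_const.mul (hm.mul ((contDiff_parDrift hB hne).continuous.comp
    continuous_fst)))).smul ((contDiff_unitField hB hne).continuous.comp hc)).add
    (((hm.smul ((contDiff_gradDrift hB hne).continuous.comp hc)).add
      ((hu.pow 2).smul ((contDiff_curvDrift hB hne).continuous.comp hc))).const_smul ω⁻¹)

lemma continuous_centreVelError (hB : ContDiff ℝ 2 B) (hne : ∀ y, B y ≠ 0) (ω : ℝ) :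
    Continuous (centreVelError B ω) := by
  have hc := continuous_centre hB hne ω
  have hu := (contDiff_parV hB hne).continuous
  have hm := (contDiff_moment hB hne).continuous
  have hb := (contDiff_unitField hB hne).continuous
  have hg := (contDiff_gradDrift hB hne).continuous
  have hk := (contDiff_curvDrift hB hne).continuous
  have hDb := (contDiff_fderiv_two (contDiff_unitField hB hne)).continuous.comp
    (continuous_fst (X := E3) (Y := E3))
  exact (hu.smul (((hb.comp hc).sub (hb.comp continuous_fst)).sub
    (hDb.clm_apply (hc.sub continuous_fst)))).neg.sub
    (((((hm.mul ((contDiff_parDrift hB hne).continuous.comp continuous_fst)).smul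
      ((hb.comp hc).sub (hb.comp continuous_fst))).add
      (hm.smul ((hg.comp hc).sub (hg.comp continuous_fst)))).add
      ((hu.pow 2).smul ((hk.comp hc).sub (hk.comp continuous_fst)))).const_smul ω⁻¹)

lemma cross_recipField_cross (hne : ∀ y, B y ≠ 0) (y v : E3) :
    cross (recipField B y) (cross v (B y)) = v - parV B (y, v) • unitField B y := by
  have hN := norm_ne_zero_iff.2 (hne y)
  rw [cross_cross_right]
  simp only [recipField, parV, unitField, inner_smul_left, real_inner_self_eq_norm_sq, conj_trivial]
  match_scalars <;> field_simp

lemma IsLorentzTrajectory.hasDerivAt_centre (hq : IsLorentzTrajectory B ω x₀ v₀ q p)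
    (hω : ω ≠ 0) (hB : ContDiff ℝ 2 B) (hne : ∀ y, B y ≠ 0) (t : ℝ) :
    HasDerivAt (fun t => centre B ω (q t, p t)) (centreVel B ω (q t, p t)
      + centreVelError B ω (q t, p t)
      + ω⁻¹ • (rawDrift B (q t, p t) - meanDrift B (q t, p t))) t := by
  have hr : HasDerivAt (fun t => recipField B (q t)) (fderiv ℝ (recipField B) (q t) (p t)) t :=
    ((contDiff_recipField hB hne).differentiable (by norm_num) (q t)).hasFDerivAt.comp_hasDerivAt t
      (hq.hasDerivAt_pos t)
  have hc := (crossL.hasFDerivAt.comp_hasDerivAt t hr).clm_apply (hq.hasDerivAt_vel t)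
  refine ((hq.hasDerivAt_pos t).sub (hc.const_smul ω⁻¹)).congr_deriv ?_
  simp only [crossL_apply, Function.comp_apply, cross_smul_right, cross_recipField_cross hne]
  have hcm : centre B ω (q t, p t) - q t = -(ω⁻¹ • cross (recipField B (q t)) (p t)) := by
    simp [centre, larmor]
  simp only [centreVel, centreVelError, rawDrift, meanDrift, hcm, map_neg, map_smul]
  match_scalars <;> field_simp <;> ring

lemma exists_larmor_bound (hB : ContDiff ℝ 2 B) (hne : ∀ y, B y ≠ 0) (x₀ v₀ : E3) (T : ℝ) :
    ∃ M, 0 ≤ M ∧ ∀ ω ≥ 1, ∀ z ∈ phaseBox x₀ v₀ T, ‖centre B ω z - z.1‖ ≤ M * ω⁻¹ ∧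
      z.1 ∈ Metric.closedBall x₀ (‖v₀‖ * T + M) ∧
      centre B ω z ∈ Metric.closedBall x₀ (‖v₀‖ * T + M) := by
  obtain ⟨M, hM, h⟩ := exists_bound_phaseBox
    (((crossL.continuous.comp ((contDiff_recipField hB hne).continuous.comp
      continuous_fst)).clm_apply continuous_snd) : Continuous fun z : E3 × E3 =>
      crossL (recipField B z.1) z.2) x₀ v₀ T
  refine ⟨M, hM, fun ω hω z hz => ?_⟩
  have hω0 : 0 < ω := by linarith
  have h1 : ‖centre B ω z - z.1‖ ≤ M * ω⁻¹ := by
    have : centre B ω z - z.1 = -(ω⁻¹ • crossL (recipField B z.1) z.2) := by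
      simp [centre, larmor, crossL_apply]
    rw [this, norm_neg, norm_smul, norm_inv, Real.norm_of_nonneg hω0.le, mul_comm]
    gcongr
    exact h z hz
  have h2 : ‖centre B ω z - z.1‖ ≤ M :=
    h1.trans (mul_le_of_le_one_right hM (inv_le_one_of_one_le₀ hω))
  have h3 : dist z.1 x₀ ≤ ‖v₀‖ * T := hz.1
  refine ⟨h1, ?_, ?_⟩
  · exact Metric.closedBall_subset_closedBall (by linarith) hz.1
  · rw [Metric.mem_closedBall]
    refine (dist_triangle _ z.1 _).trans ?_
    rw [dist_eq_norm (centre B ω z)]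
    linarith

lemma exists_centreVelError_bound (hB : ContDiff ℝ 2 B) (hne : ∀ y, B y ≠ 0) (x₀ v₀ : E3) (T : ℝ) :
    ∃ C, 0 ≤ C ∧ ∀ ω ≥ 1, ∀ z ∈ phaseBox x₀ v₀ T, ‖centreVelError B ω z‖ ≤ C * ω⁻¹ ^ 2 := by
  obtain ⟨M, hM, hlar⟩ := exists_larmor_bound hB hne x₀ v₀ T
  have hb := contDiff_unitField hB hne
  obtain ⟨A, hA, htay⟩ := exists_taylor_closedBall hb x₀ (‖v₀‖ * T + M)
  obtain ⟨L₁, hL₁, hlip₁⟩ := exists_lipschitz_closedBall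
    (hb.of_le (show (1 : WithTop ℕ∞) ≤ 2 by norm_num)) x₀ (‖v₀‖ * T + M)
  obtain ⟨L₂, hL₂, hlip₂⟩ := exists_lipschitz_closedBall (contDiff_gradDrift hB hne) x₀
    (‖v₀‖ * T + M)
  obtain ⟨L₃, hL₃, hlip₃⟩ := exists_lipschitz_closedBall (contDiff_curvDrift hB hne) x₀
    (‖v₀‖ * T + M)
  have hu := (contDiff_parV hB hne).continuous
  have hm := (contDiff_moment hB hne).continuous
  obtain ⟨K₀, hK₀, hk₀⟩ := exists_bound_phaseBox hu x₀ v₀ T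
  obtain ⟨K₁, hK₁, hk₁⟩ := exists_bound_phaseBox
    (hm.mul ((contDiff_parDrift hB hne).continuous.comp continuous_fst)) x₀ v₀ T
  obtain ⟨K₂, hK₂, hk₂⟩ := exists_bound_phaseBox hm x₀ v₀ T
  obtain ⟨K₃, hK₃, hk₃⟩ := exists_bound_phaseBox (hu.pow 2) x₀ v₀ T
  refine ⟨K₀ * (A * M ^ 2) + (K₁ * (L₁ * M) + K₂ * (L₂ * M) + K₃ * (L₃ * M)), by positivity,
    fun ω hω z hz => ?_⟩
  obtain ⟨hd, hz₁, hz₂⟩ := hlar ω hω z hz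
  have hω0 : 0 < ω := by linarith
  have t₀ := (htay _ hz₁ _ hz₂).trans (show _ ≤ A * (M * ω⁻¹) ^ 2 by gcongr)
  have t₁ := (hlip₁ _ hz₁ _ hz₂).trans (show _ ≤ L₁ * (M * ω⁻¹) by gcongr)
  have t₂ := (hlip₂ _ hz₁ _ hz₂).trans (show _ ≤ L₂ * (M * ω⁻¹) by gcongr)
  have t₃ := (hlip₃ _ hz₁ _ hz₂).trans (show _ ≤ L₃ * (M * ω⁻¹) by gcongr)
  have key : ∀ {a : ℝ} {w : E3} {K S : ℝ}, ‖a‖ ≤ K → ‖w‖ ≤ S → 0 ≤ K → ‖a • w‖ ≤ K * S :=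
    fun ha hw hK => by
      rw [norm_smul]
      exact mul_le_mul ha hw (norm_nonneg _) hK
  rw [centreVelError]
  calc _ ≤ K₀ * (A * (M * ω⁻¹) ^ 2) + ω⁻¹ * (K₁ * (L₁ * (M * ω⁻¹)) + K₂ * (L₂ * (M * ω⁻¹))
        + K₃ * (L₃ * (M * ω⁻¹))) := by
        refine (norm_sub_le _ _).trans (add_le_add ?_ (key ?_ ?_ (by positivity)))
        · rw [norm_neg]
          exact key (hk₀ z hz) t₀ hK₀
        · rw [norm_inv, Real.norm_of_nonneg hω0.le]
        · exact (norm_add₃_le).trans (add_le_add (add_le_add (key (hk₁ z hz) t₁ hK₁)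
            (key (hk₂ z hz) t₂ hK₂)) (key (hk₃ z hz) t₃ hK₃))
    _ = _ := by ring

/-- The guiding centre follows the effective velocity up to an error of order `1 / ω²`. -/
lemma exists_centre_remainder_bound (hB : ContDiff ℝ 2 B) (hne : ∀ y, B y ≠ 0) (x₀ v₀ : E3)
    (T : ℝ) :
    ∃ C, 0 ≤ C ∧ ∀ ω ≥ 1, ∀ q p, IsLorentzTrajectory B ω x₀ v₀ q p → ∀ t, |t| ≤ T →
      ‖centre B ω (q t, p t) - centre B ω (q 0, p 0)
        - ∫ s in (0 : ℝ)..t, centreVel B ω (q s, p s)‖ ≤ C * ω⁻¹ ^ 2 := by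
  obtain ⟨C₁, hC₁, h₁⟩ := exists_centreVelError_bound hB hne x₀ v₀ T
  have hΦ := contDiff_driftPrimitive hB hne
  have hgyr := hasDerivAt_driftPrimitive hB hne
  obtain ⟨C₂, hC₂, h₂⟩ := exists_averaging_bound hB.continuous hΦ hgyr
    (g := fun z => rawDrift B z - meanDrift B z) x₀ v₀ T
  have hcont := continuous_gyration_deriv hB.continuous hΦ hgyr
    (g := fun z => rawDrift B z - meanDrift B z)
  refine ⟨C₁ * |T| + C₂, by positivity, fun ω hω q p hq t ht => ?_⟩
  have hω0 : 0 < ω := by linarith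
  have hph := hq.continuous_phase
  have i₁ : IntervalIntegrable (fun s => centreVel B ω (q s, p s)) volume 0 t :=
    ((continuous_centreVel hB hne ω).comp hph).intervalIntegrable 0 t
  have i₂ : IntervalIntegrable (fun s => centreVelError B ω (q s, p s)) volume 0 t :=
    ((continuous_centreVelError hB hne ω).comp hph).intervalIntegrable 0 t
  have i₃ : IntervalIntegrable (fun s => ω⁻¹ • (rawDrift B (q s, p s) - meanDrift B (q s, p s)))
      volume 0 t := ((hcont.comp hph).const_smul ω⁻¹).intervalIntegrable 0 t
  have hftc := intervalIntegral.integral_eq_sub_of_hasDerivAt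
    (fun s _ => hq.hasDerivAt_centre hω0.ne' hB hne s) ((i₁.add i₂).add i₃)
  rw [intervalIntegral.integral_add (i₁.add i₂) i₃, intervalIntegral.integral_add i₁ i₂,
    intervalIntegral.integral_smul] at hftc
  rw [← hftc, add_assoc, add_sub_cancel_left]
  have hb : ‖∫ s in (0 : ℝ)..t, centreVelError B ω (q s, p s)‖ ≤ C₁ * ω⁻¹ ^ 2 * |t - 0| := by
    refine intervalIntegral.norm_integral_le_of_norm_le_const fun s hs =>
      h₁ ω hω _ (hq.mem_phaseBox ?_)
    have := Set.abs_sub_left_of_mem_uIcc (Set.uIoc_subset_uIcc hs)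
    simp at this
    exact this.trans ht
  have ha : ‖ω⁻¹ • ∫ s in (0 : ℝ)..t, (rawDrift B (q s, p s) - meanDrift B (q s, p s))‖
      ≤ ω⁻¹ * (C₂ / ω) := by
    rw [norm_smul, norm_inv, Real.norm_of_nonneg hω0.le]
    gcongr
    exact h₂ ω hω0 q p hq t ht
  have hbT : C₁ * ω⁻¹ ^ 2 * |t - 0| ≤ C₁ * ω⁻¹ ^ 2 * |T| := by
    rw [sub_zero]
    exact mul_le_mul_of_nonneg_left (ht.trans (le_abs_self T)) (by positivity)
  calc _ ≤ C₁ * ω⁻¹ ^ 2 * |T| + ω⁻¹ * (C₂ / ω) :=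
        (norm_add_le _ _).trans (add_le_add (hb.trans hbT) ha)
    _ = _ := by rw [div_eq_mul_inv]; ring

end GuidingCentre

section Limits

lemma tendstoLocallyUniformly_zero_of_bound {F : Type*} [NormedAddCommGroup F] {f : ℝ → ℝ → F}
    (hf : ∀ T e : ℝ, 0 < e → ∃ W, ∀ ω ≥ W, ∀ t, |t| ≤ T → ‖f ω t‖ ≤ e) :
    TendstoLocallyUniformly f (fun _ => (0 : F)) atTop := by
  rw [Metric.tendstoLocallyUniformly_iff]
  intro e he t
  obtain ⟨W, hW⟩ := hf (|t| + 1) (e / 2) (by linarith)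
  refine ⟨Metric.closedBall t 1, Metric.closedBall_mem_nhds t one_pos,
    (eventually_ge_atTop W).mono fun ω hω s hs => ?_⟩
  rw [dist_zero_left]
  refine (hW ω hω s ?_).trans_lt (by linarith)
  have h1 : |s - t| ≤ 1 := hs
  have h2 := abs_sub_abs_le_abs_sub s t
  linarith

lemma exists_mul_inv_le (C : ℝ) {e : ℝ} (he : 0 < e) : ∃ W ≥ (1 : ℝ), ∀ ω ≥ W, C * ω⁻¹ ≤ e := by
  refine ⟨max 1 (C / e), le_max_left _ _, fun ω hω => ?_⟩
  have h1 : 0 < ω := lt_of_lt_of_le one_pos ((le_max_left _ _).trans hω)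
  have h2 : C / e ≤ ω := (le_max_right _ _).trans hω
  rw [div_le_iff₀ he] at h2
  rw [← div_eq_mul_inv, div_le_iff₀ h1]
  linarith

variable {B : E3 → E3} {x₀ v₀ : E3} {q p : ℝ → ℝ → E3} {x : ℝ → E3} {h : ℝ → ℝ}

lemma parV_zero_eq (hB : ContDiff ℝ 2 B) (hne : ∀ y, B y ≠ 0)
    (hq : ∀ ω > 0, IsLorentzTrajectory B ω x₀ v₀ (q ω) (p ω))
    (hx : ContDiff ℝ 2 x) (hxh : ∀ t, deriv x t = h t • unitField B (x t))
    (hconv : HolderLocConv q x 0) : parV B (x₀, v₀) = h 0 := by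
  refine eq_of_abs_sub_nonpos (le_of_forall_pos_le_add fun e he => ?_)
  obtain ⟨W, hW⟩ := tendsto_parV hB hne hq hx hxh hconv 0 he
  have htraj := hq (max W 1) (lt_of_lt_of_le one_pos (le_max_right _ _))
  have := hW (max W 1) (le_max_left _ _) 0 (by simp)
  rw [htraj.pos_zero, htraj.vel_zero] at this
  linarith

lemma tendsto_parallel_correction (hB : ContDiff ℝ 2 B) (hne : ∀ y, B y ≠ 0)
    (hq : ∀ ω > 0, IsLorentzTrajectory B ω x₀ v₀ (q ω) (p ω))
    (hx : ContDiff ℝ 2 x) (hxh : ∀ t, deriv x t = h t • unitField B (x t))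
    (hconv : HolderLocConv q x 0) :
    TendstoLocallyUniformly (fun ω t => parV B (q ω t, p ω t) - h t
      + ω⁻¹ * (moment B (q ω t, p ω t) * parDrift B (q ω t))) (fun _ => (0 : ℝ)) atTop := by
  refine tendstoLocallyUniformly_zero_of_bound fun T e he => ?_
  obtain ⟨C, hC, hbd⟩ := exists_bound_phaseBox ((contDiff_moment hB hne).continuous.mul
    ((contDiff_parDrift hB hne).continuous.comp continuous_fst)) x₀ v₀ T
  obtain ⟨W₁, h₁⟩ := tendsto_parV hB hne hq hx hxh hconv T (half_pos he)
  obtain ⟨W₂, hW₂, h₂⟩ := exists_mul_inv_le C (half_pos he)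
  refine ⟨max W₁ W₂, fun ω hω t ht => ?_⟩
  have hω₂ : W₂ ≤ ω := (le_max_right _ _).trans hω
  have hω0 : 0 < ω := by linarith
  have a1 := h₁ ω ((le_max_left _ _).trans hω) t ht
  have a2 := hbd _ ((hq ω hω0).mem_phaseBox ht)
  have a3 : ‖ω⁻¹ * (moment B (q ω t, p ω t) * parDrift B (q ω t))‖ ≤ e / 2 := by
    rw [norm_mul, norm_inv, Real.norm_of_nonneg hω0.le, mul_comm]
    exact (mul_le_mul_of_nonneg_right a2 (by positivity)).trans (h₂ ω hω₂)
  exact (norm_add_le _ _).trans (by rw [Real.norm_eq_abs (_ - _)]; linarith)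

lemma tendsto_perp_correction (hB : ContDiff ℝ 2 B) (hne : ∀ y, B y ≠ 0)
    (hdiv : ∀ y, divergence B y = 0)
    (hq : ∀ ω > 0, IsLorentzTrajectory B ω x₀ v₀ (q ω) (p ω))
    (hx : ContDiff ℝ 2 x) (hxh : ∀ t, deriv x t = h t • unitField B (x t))
    (hconv : HolderLocConv q x 0) {f g : E3 → E3} (hf : Continuous f) (hg : Continuous g) :
    TendstoLocallyUniformly (fun ω t =>
      (moment B (q ω t, p ω t) - moment B (x₀, v₀)) • f (centre B ω (q ω t, p ω t))
        + (parV B (q ω t, p ω t) ^ 2 - h t ^ 2) • g (centre B ω (q ω t, p ω t)))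
      (fun _ => (0 : E3)) atTop := by
  refine tendstoLocallyUniformly_zero_of_bound fun T e he => ?_
  obtain ⟨M, hM, hlar⟩ := exists_larmor_bound hB hne x₀ v₀ T
  obtain ⟨Cf, hCf⟩ := (isCompact_closedBall x₀ (‖v₀‖ * T + M)).exists_bound_of_continuousOn
    hf.continuousOn
  obtain ⟨Cg, hCg⟩ := (isCompact_closedBall x₀ (‖v₀‖ * T + M)).exists_bound_of_continuousOn
    hg.continuousOn
  obtain ⟨Cm, hCm, hmom⟩ := exists_moment_bound hB hne hdiv x₀ v₀ T
  obtain ⟨Cu, hCu, hu⟩ := exists_bound_phaseBox (contDiff_parV hB hne).continuous x₀ v₀ T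
  set d : ℝ := min 1 (e / 2 / ((2 * Cu + 1) * (|Cg| + 1))) with hd
  have hd0 : 0 < d := by positivity
  have hde : d * ((2 * Cu + 1) * (|Cg| + 1)) ≤ e / 2 := by
    rw [← le_div_iff₀ (by positivity)]
    exact min_le_right _ _
  obtain ⟨W₁, h₁⟩ := tendsto_parV hB hne hq hx hxh hconv T hd0
  obtain ⟨W₂, hW₂, h₂⟩ := exists_mul_inv_le (Cm * |Cf|) (half_pos he)
  refine ⟨max W₁ W₂, fun ω hω t ht => ?_⟩
  have hω₂ : W₂ ≤ ω := (le_max_right _ _).trans hω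
  have hω1 : 1 ≤ ω := hW₂.trans hω₂
  have hω0 : 0 < ω := by linarith
  have hbox := (hq ω hω0).mem_phaseBox ht
  have hR := (hlar ω hω1 _ hbox).2.2
  have a1 := h₁ ω ((le_max_left _ _).trans hω) t ht
  have a2 := hmom ω hω0 _ _ (hq ω hω0) t ht
  have a3 := hu _ hbox
  have a4 := (hCf _ hR).trans (le_abs_self Cf)
  have a5 := (hCg _ hR).trans (le_abs_self Cg)
  have b1 : ‖(moment B (q ω t, p ω t) - moment B (x₀, v₀)) • f (centre B ω (q ω t, p ω t))‖
      ≤ e / 2 := by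
    rw [norm_smul]
    refine (mul_le_mul a2 a4 (norm_nonneg _) (by positivity)).trans ?_
    rw [div_eq_mul_inv, mul_right_comm]
    exact h₂ ω hω₂
  have b2 : ‖(parV B (q ω t, p ω t) ^ 2 - h t ^ 2) • g (centre B ω (q ω t, p ω t))‖
      ≤ e / 2 := by
    have hsum : ‖parV B (q ω t, p ω t) + h t‖ ≤ 2 * Cu + 1 := by
      have e1 : parV B (q ω t, p ω t) + h t
          = 2 * parV B (q ω t, p ω t) - (parV B (q ω t, p ω t) - h t) := by ring
      have e2 : d ≤ 1 := min_le_left _ _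
      rw [e1]
      refine (norm_sub_le _ _).trans ?_
      rw [norm_mul, Real.norm_two, Real.norm_eq_abs (_ - _)]
      linarith
    rw [norm_smul, sq_sub_sq, norm_mul]
    calc _ ≤ (2 * Cu + 1) * d * (|Cg| + 1) := by
          refine mul_le_mul (mul_le_mul hsum a1 (norm_nonneg _) (by positivity)) (by linarith)
            (norm_nonneg _) (by positivity)
      _ = d * ((2 * Cu + 1) * (|Cg| + 1)) := by ring
      _ ≤ _ := hde
  exact (norm_add_le _ _).trans (by linarith)

end Limits

/-- Theorem 1.4 (first order expansion of the guiding centre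
$R_\omega = x_\omega - \rho_\omega$ with gyromotion
$\rho_\omega = (b(x_\omega)\times v_\omega)/(\omega|B(x_\omega)|)$). -/
theorem stmt8 (B : E3 → E3) (hB : ContDiff ℝ 2 B) (hne : ∀ y : E3, B y ≠ 0)
    (hdiv : ∀ y : E3, divergence B y = 0) (x₀ v₀ : E3)
    (b : E3 → E3) (hb : b = fun y => ‖B y‖⁻¹ • B y)
    (xω : ℝ → ℝ → E3)
    (hxC : ∀ ω > (0:ℝ), ContDiff ℝ 2 (xω ω))
    (hode : ∀ ω > (0:ℝ), ∀ t : ℝ,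
      deriv (deriv (xω ω)) t = ω • cross (deriv (xω ω) t) (B (xω ω t)))
    (hinit : ∀ ω > (0:ℝ), xω ω 0 = x₀ ∧ deriv (xω ω) 0 = v₀)
    (x : ℝ → E3) (h : ℝ → ℝ) (hx3 : ContDiff ℝ 3 x) (hh2 : ContDiff ℝ 2 h)
    (hconv : ∀ α : ℝ, 0 ≤ α → α < 1 → HolderLocConv xω x α)
    (hxh : ∀ t : ℝ, deriv x t = h t • b (x t))
    (μ₀ : ℝ) (hμ₀ : μ₀ = (‖v₀‖ ^ 2 - h 0 ^ 2) / (2 * ‖B x₀‖))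
    (κ : E3 → E3) (hκ : κ = fun y => fderiv ℝ b y (b y))
    (ρω : ℝ → ℝ → E3)
    (hρ : ∀ ω t, ρω ω t = (ω * ‖B (xω ω t)‖)⁻¹ • cross (b (xω ω t)) (deriv (xω ω) t))
    (Rω : ℝ → ℝ → E3) (hR : ∀ ω t, Rω ω t = xω ω t - ρω ω t) :
    ∃ ε : ℝ → ℝ → ℝ, ∃ δ : ℝ → ℝ → E3, ∃ r : ℝ → ℝ → E3,
      TendstoLocallyUniformly ε (fun _ => (0:ℝ)) atTop ∧
      TendstoLocallyUniformly δ (fun _ => (0:E3)) atTop ∧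
      TendstoLocallyUniformly (fun ω t => ω • r ω t) (fun _ => (0:E3)) atTop ∧
      ∀ ω > (0:ℝ), ∀ t : ℝ,
        Rω ω t = x₀ + (∫ s in (0:ℝ)..t, (h s + ε ω s) • b (Rω ω s))
          + ω⁻¹ • (‖B x₀‖⁻¹ • cross v₀ (b x₀)
            + ∫ s in (0:ℝ)..t, cross (‖B (Rω ω s)‖⁻¹ • b (Rω ω s))
                (μ₀ • gradient (fun y => ‖B y‖) (Rω ω s) + h s ^ 2 • κ (Rω ω s) + δ ω s))
          + r ω t := by
  have hb' : b = unitField B := hb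
  subst hb'
  have hq : ∀ ω > (0 : ℝ), IsLorentzTrajectory B ω x₀ v₀ (xω ω) (deriv (xω ω)) := fun ω hω => by
    have h1 : ContDiff ℝ 1 (deriv (xω ω)) := (contDiff_succ_iff_deriv.1 (hxC ω hω)).2.2
    refine ⟨fun t => ((hxC ω hω).differentiable (by norm_num) t).hasDerivAt, fun t => ?_,
      (hinit ω hω).1, (hinit ω hω).2⟩
    rw [← hode ω hω t]
    exact (h1.differentiable (by norm_num) t).hasDerivAt
  have hx2 : ContDiff ℝ 2 x := hx3.of_le (by norm_num)
  have hconv0 := hconv 0 le_rfl one_pos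
  have hμ : moment B (x₀, v₀) = μ₀ := by
    rw [hμ₀, moment, parV_zero_eq hB hne hq hx2 hxh hconv0]
  have hRc : ∀ ω t, Rω ω t = centre B ω (xω ω t, deriv (xω ω) t) := fun ω t => by
    rw [hR, hρ, centre, larmor, recipField_eq, cross_smul_left, smul_smul, mul_inv]
  subst hκ
  set ε : ℝ → ℝ → ℝ := fun ω t => parV B (xω ω t, deriv (xω ω) t) - h t
    + ω⁻¹ * (moment B (xω ω t, deriv (xω ω) t) * parDrift B (xω ω t)) with hε
  set δ : ℝ → ℝ → E3 := fun ω t =>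
    (moment B (xω ω t, deriv (xω ω) t) - moment B (x₀, v₀)) •
        gradient (fun y => ‖B y‖) (centre B ω (xω ω t, deriv (xω ω) t))
      + (parV B (xω ω t, deriv (xω ω) t) ^ 2 - h t ^ 2) •
        (fun y => fderiv ℝ (unitField B) y (unitField B y))
          (centre B ω (xω ω t, deriv (xω ω) t)) with hδ
  refine ⟨ε, δ, fun ω t => Rω ω t - (x₀ + (∫ s in (0:ℝ)..t, (h s + ε ω s) • unitField B (Rω ω s))
      + ω⁻¹ • (‖B x₀‖⁻¹ • cross v₀ (unitField B x₀)
        + ∫ s in (0:ℝ)..t, cross (‖B (Rω ω s)‖⁻¹ • unitField B (Rω ω s))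
          (μ₀ • gradient (fun y => ‖B y‖) (Rω ω s)
            + h s ^ 2 • (fun y => fderiv ℝ (unitField B) y (unitField B y)) (Rω ω s) + δ ω s))),
    tendsto_parallel_correction hB hne hq hx2 hxh hconv0,
    tendsto_perp_correction hB hne hdiv hq hx2 hxh hconv0 (contDiff_gradient_norm hB hne).continuous
      (contDiff_curvature hB hne).continuous, ?_, fun ω _ t => (add_sub_cancel _ _).symm⟩
  refine tendstoLocallyUniformly_zero_of_bound fun T e he => ?_
  obtain ⟨C, hC, hrem⟩ := exists_centre_remainder_bound hB hne x₀ v₀ T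
  obtain ⟨W, hW1, hW⟩ := exists_mul_inv_le C he
  refine ⟨W, fun ω hω t ht => ?_⟩
  have hω1 : 1 ≤ ω := hW1.trans hω
  have hω0 : 0 < ω := by linarith
  have htraj := hq ω hω0
  have hph := htraj.continuous_phase
  have hc := (continuous_centre hB hne ω).comp hph
  have hu := (contDiff_parV hB hne).continuous.comp hph
  have hm := (contDiff_moment hB hne).continuous.comp hph
  have e1 : ∀ s, (h s + ε ω s) • unitField B (Rω ω s)
      = (parV B (xω ω s, deriv (xω ω) s) + ω⁻¹ * (moment B (xω ω s, deriv (xω ω) s)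
        * parDrift B (xω ω s))) • unitField B (centre B ω (xω ω s, deriv (xω ω) s)) := fun s => by
    rw [hRc, hε]
    congr 1
    ring
  have e2 : ∀ s, cross (‖B (Rω ω s)‖⁻¹ • unitField B (Rω ω s))
      (μ₀ • gradient (fun y => ‖B y‖) (Rω ω s)
        + h s ^ 2 • (fun y => fderiv ℝ (unitField B) y (unitField B y)) (Rω ω s) + δ ω s)
      = moment B (xω ω s, deriv (xω ω) s) • gradDrift B (centre B ω (xω ω s, deriv (xω ω) s))
        + parV B (xω ω s, deriv (xω ω) s) ^ 2 •
          curvDrift B (centre B ω (xω ω s, deriv (xω ω) s)) := fun s => by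
    rw [hRc, gradDrift, curvDrift, ← cross_smul_right, ← cross_smul_right, ← cross_add_right, hδ, hμ]
    congr 1
    module
  have i1 : IntervalIntegrable (fun s => (parV B (xω ω s, deriv (xω ω) s)
      + ω⁻¹ * (moment B (xω ω s, deriv (xω ω) s) * parDrift B (xω ω s))) •
        unitField B (centre B ω (xω ω s, deriv (xω ω) s))) volume 0 t :=
    ((hu.add (continuous_const.mul (hm.mul ((contDiff_parDrift hB hne).continuous.comp
      hph.fst)))).smul ((contDiff_unitField hB hne).continuous.comp hc)).intervalIntegrable 0 t
  have i2 : IntervalIntegrable (fun s => ω⁻¹ • (moment B (xω ω s, deriv (xω ω) s) •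
      gradDrift B (centre B ω (xω ω s, deriv (xω ω) s)) + parV B (xω ω s, deriv (xω ω) s) ^ 2 •
        curvDrift B (centre B ω (xω ω s, deriv (xω ω) s)))) volume 0 t :=
    (((hm.smul ((contDiff_gradDrift hB hne).continuous.comp hc)).add
      ((hu.pow 2).smul ((contDiff_curvDrift hB hne).continuous.comp hc))).const_smul
        ω⁻¹).intervalIntegrable 0 t
  have h0 : centre B ω (xω ω 0, deriv (xω ω) 0)
      = x₀ + ω⁻¹ • ‖B x₀‖⁻¹ • cross v₀ (unitField B x₀) := by
    rw [htraj.pos_zero, htraj.vel_zero, centre, larmor, recipField_eq, cross_smul_left,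
      e3cross_anticomm (unitField B x₀)]
    module
  have hr := hrem ω hω1 _ _ htraj t ht
  simp only [centreVel] at hr
  rw [intervalIntegral.integral_add i1 i2, intervalIntegral.integral_smul, h0] at hr
  simp only [e1, e2]
  rw [hRc, norm_smul, Real.norm_of_nonneg hω0.le]
  calc _ ≤ ω * (C * ω⁻¹ ^ 2) := by
        gcongr
        refine le_trans (le_of_eq ?_) hr
        congr 1
        module
    _ = C * ω⁻¹ := by field_simp
    _ ≤ e := hW ω hω
end
end

section
/- Define the perpendicular velocity v⊥_ω(t) := v_ω(t) − (v_ω(t)·b(x_ω(t))) b(x_ω(t)). Then |v⊥_ω(t)| ≤ |v₀| for all t and ω, and v⊥_ω converges weakly to 0 in L^p_loc(ℝ,ℝ³) for every 1 ≤ p < ∞ as ω → ∞; in particular ∫_ℝ g(t)·v⊥_ω(t) dt → 0 for every continuous compactly supported g : ℝ → ℝ³. -/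
open MeasureTheory Filter RealInnerProductSpace

noncomputable section

/-- The cross product as a continuous bilinear map. -/
def crossCLM : E3 →L[ℝ] E3 →L[ℝ] E3 :=
  LinearMap.toContinuousBilinearMap <| LinearMap.mk₂ ℝ cross
    (fun u v w => by ext i; fin_cases i <;> simp [cross] <;> ring)
    (fun c u v => by ext i; fin_cases i <;> simp [cross] <;> ring)
    (fun u v w => by ext i; fin_cases i <;> simp [cross] <;> ring)
    (fun c u v => by ext i; fin_cases i <;> simp [cross] <;> ring)

theorem crossCLM_apply (u v : E3) : crossCLM u v = cross u v := rfl

theorem cross_zero_left (v : E3) : cross 0 v = 0 := by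
  rw [← crossCLM_apply, map_zero, zero_apply]

theorem continuous_cross {X : Type*} [TopologicalSpace X] {f h : X → E3}
    (hf : Continuous f) (hh : Continuous h) : Continuous fun t => cross (f t) (h t) := by
  simp only [← crossCLM_apply]
  fun_prop

theorem HasDerivAt.cross {f h : ℝ → E3} {f' h' : E3} {t : ℝ}
    (hf : HasDerivAt f f' t) (hh : HasDerivAt h h' t) :
    HasDerivAt (fun s => cross (f s) (h s)) (cross f' (h t) + cross (f t) h') t := by
  have := crossCLM.hasDerivAt_of_bilinear (fun _ => hf) (fun _ => hh)
  rw [add_comm]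
  exact this

theorem inner_self_cross (u v : E3) : ⟪u, cross u v⟫ = 0 := by
  simp [cross, PiLp.inner_apply, Fin.sum_univ_three]
  ring

/-- The Binet–Cauchy identity. -/
theorem inner_cross_cross (a b c d : E3) :
    ⟪cross a b, cross c d⟫ = ⟪a, c⟫ * ⟪b, d⟫ - ⟪a, d⟫ * ⟪b, c⟫ := by
  simp [cross, PiLp.inner_apply, Fin.sum_univ_three]
  ring

/-- Removing the component along a unit vector does not increase the norm. -/
theorem norm_sub_inner_smul_le {b : E3} (hb : ‖b‖ = 1) (v : E3) :
    ‖v - ⟪v, b⟫ • b‖ ≤ ‖v‖ := by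
  refine le_of_sq_le_sq ?_ (norm_nonneg v)
  rw [norm_sub_sq_real, inner_smul_right, norm_smul, hb, mul_one, Real.norm_eq_abs, sq_abs]
  nlinarith [sq_nonneg ⟪v, b⟫]

theorem HasDerivAt.norm_eq_of_inner_eq_zero {v v' : ℝ → E3}
    (hv : ∀ t, HasDerivAt v (v' t) t) (h : ∀ t, ⟪v t, v' t⟫ = 0) (s t : ℝ) :
    ‖v s‖ = ‖v t‖ := by
  have hd : ∀ r, HasDerivAt (fun r => ‖v r‖ ^ 2) 0 r := fun r => by
    simpa [h r] using (hv r).norm_sq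
  have := is_const_of_deriv_eq_zero (fun r => (hd r).differentiableAt) (fun r => (hd r).deriv) s t
  exact (sq_eq_sq₀ (norm_nonneg _) (norm_nonneg _)).1 this

/-- Along a charged particle trajectory, the perpendicular velocity tested against a `C¹`
function with compact support is `O(1/ω)`, uniformly in the trajectory. -/
theorem exists_integral_inner_perp_le {B : E3 → E3} (hB : ContDiff ℝ 1 B)
    (hne : ∀ y, B y ≠ 0) (x₀ : E3) (V : ℝ) {g : ℝ → E3} (hg : ContDiff ℝ 1 g)
    (hgs : HasCompactSupport g) :
    ∃ C : ℝ, ∀ ω > (0 : ℝ), ∀ x v : ℝ → E3, x 0 = x₀ → (∀ t, ‖v t‖ ≤ V) →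
      (∀ t, HasDerivAt x (v t) t) →
      (∀ t, HasDerivAt v (ω • cross (v t) (B (x t))) t) →
      |∫ t, ⟪g t, v t - ⟪v t, ‖B (x t)‖⁻¹ • B (x t)⟫ • ‖B (x t)‖⁻¹ • B (x t)⟫| ≤ C / ω := by
  set F : E3 → E3 := fun y => (‖B y‖ ^ 2)⁻¹ • B y with hF
  have hFC : ContDiff ℝ 1 F :=
    ((hB.norm_sq ℝ).inv fun y => by simpa using hne y).smul hB
  obtain ⟨T, hT⟩ := hgs.isCompact.isBounded.subset_closedBall 0
  rw [Real.closedBall_eq_Icc, zero_sub, zero_add] at hT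
  have hg0 : ∀ t ∉ Set.Icc (-T) T, g t = 0 := fun t ht =>
    image_eq_zero_of_notMem_tsupport fun h => ht (hT h)
  have hg0' : ∀ t ∉ Set.Icc (-T) T, deriv g t = 0 := fun t ht =>
    image_eq_zero_of_notMem_tsupport fun h => ht (hT (tsupport_deriv_subset h))
  set G : ℝ × E3 × E3 → ℝ := fun z =>
    ⟪cross (deriv g z.1) (F z.2.1) + cross (g z.1) (fderiv ℝ F z.2.1 z.2.2), z.2.2⟫ with hG
  have hdg : Continuous (deriv g) := hg.continuous_deriv le_rfl
  have hgc : Continuous g := hg.continuous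
  have hFc : Continuous F := hFC.continuous
  have hdF : Continuous (fderiv ℝ F) := hFC.continuous_fderiv one_ne_zero
  have hGc : Continuous G := by
    refine Continuous.inner (.add (continuous_cross ?_ ?_) (continuous_cross ?_ ?_)) ?_ <;>
      fun_prop
  obtain ⟨C, hC⟩ := ((isCompact_Icc (a := -T) (b := T)).prod
    ((isCompact_closedBall x₀ (V * T)).prod
      (isCompact_closedBall (0 : E3) V))).exists_bound_of_continuousOn hGc.continuousOn
  refine ⟨C * volume.real (Set.Icc (-T) T), fun ω hω x v hx0 hV hx hv => ?_⟩
  have hxc : Continuous x := continuous_iff_continuousAt.2 fun t => (hx t).continuousAt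
  have hvc : Continuous v := continuous_iff_continuousAt.2 fun t => (hv t).continuousAt
  have hmem : ∀ t ∈ Set.Icc (-T) T, x t ∈ Metric.closedBall x₀ (V * T) := fun t ht => by
    have hV0 : 0 ≤ V := (norm_nonneg _).trans (hV 0)
    have := Convex.norm_image_sub_le_of_norm_hasDerivWithin_le (s := Set.univ) (x := 0) (y := t)
      (fun r _ => (hx r).hasDerivWithinAt) (fun r _ => hV r) convex_univ trivial trivial
    rw [hx0, sub_zero] at this
    rw [mem_closedBall_iff_norm]
    exact this.trans (mul_le_mul_of_nonneg_left (abs_le.2 ht) hV0)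
  have hGz : ∀ t ∉ Set.Icc (-T) T, G (t, x t, v t) = 0 := fun t ht => by
    simp [hG, hg0 t ht, hg0' t ht, cross_zero_left]
  have hGx : Continuous fun t => G (t, x t, v t) := by fun_prop
  have hGi : Integrable fun t => G (t, x t, v t) :=
    hGx.integrable_of_hasCompactSupport (.intro isCompact_Icc fun t ht => hGz t ht)
  have hbound : |∫ t, G (t, x t, v t)| ≤ C * volume.real (Set.Icc (-T) T) := by
    rw [← setIntegral_eq_integral_of_forall_compl_eq_zero (s := Set.Icc (-T) T) hGz]
    rw [← Real.norm_eq_abs]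
    refine norm_setIntegral_le_of_norm_le_const measure_Icc_lt_top fun t ht => ?_
    exact hC (t, x t, v t) ⟨ht, hmem t ht, by simpa using hV t⟩
  set P : ℝ → ℝ := fun t =>
    ⟪g t, v t - ⟪v t, ‖B (x t)‖⁻¹ • B (x t)⟫ • ‖B (x t)‖⁻¹ • B (x t)⟫ with hP
  have hBx : Continuous fun t => B (x t) := hB.continuous.comp hxc
  have hPi : Integrable P := by
    refine Continuous.integrable_of_hasCompactSupport ?_
      (.intro isCompact_Icc fun t (ht : t ∉ Set.Icc (-T) T) => by simp [hP, hg0 t ht])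
    have hb : Continuous fun t => ‖B (x t)‖⁻¹ • B (x t) :=
      (hBx.norm.inv₀ fun t => by simpa using hne (x t)).smul hBx
    fun_prop
  have hderiv : ∀ t, HasDerivAt (fun s => ⟪cross (g s) (F (x s)), v s⟫)
      (ω * P t + G (t, x t, v t)) t := fun t => by
    have h1 := (((hg.differentiable one_ne_zero) t).hasDerivAt.cross
      (((hFC.differentiable one_ne_zero) (x t)).hasFDerivAt.comp_hasDerivAt t (hx t))).inner ℝ
        (hv t)
    refine h1.congr_deriv ?_
    congr 1
    have hn : ‖B (x t)‖ ≠ 0 := by simpa using hne (x t)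
    simp only [Function.comp, inner_smul_right, inner_cross_cross, hP, hF, inner_sub_right,
      inner_smul_left, real_inner_self_eq_norm_sq, RCLike.conj_to_real,
      real_inner_comm (B (x t)) (v t)]
    field_simp
  have hΦc : Continuous fun s => ⟪cross (g s) (F (x s)), v s⟫ :=
    (continuous_cross hgc (hFc.comp hxc)).inner hvc
  have hΦi : Integrable fun s => ⟪cross (g s) (F (x s)), v s⟫ :=
    hΦc.integrable_of_hasCompactSupport
      (.intro isCompact_Icc fun t (ht : t ∉ Set.Icc (-T) T) => by
        rw [hg0 t ht, cross_zero_left, inner_zero_left])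
  have hzero := integral_eq_zero_of_hasDerivAt_of_integrable hderiv
    ((hPi.const_mul ω).add hGi) hΦi
  rw [integral_add (hPi.const_mul ω) hGi, integral_const_mul] at hzero
  rwa [eq_neg_of_add_eq_zero_right hzero, abs_neg, abs_mul, abs_of_pos hω, mul_comm,
    ← le_div_iff₀ hω] at hbound

/-- A uniformly bounded family of functions that vanishes weakly against smooth compactly
supported functions vanishes weakly against every integrable function. -/
theorem tendsto_integral_inner_of_contDiff {ι : Type*} {l : Filter ι} {w : ι → ℝ → E3} {V : ℝ}
    (hw : ∀ᶠ i in l, Continuous (w i) ∧ ∀ t, ‖w i t‖ ≤ V)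
    (h : ∀ g : ℝ → E3, ContDiff ℝ 1 g → HasCompactSupport g →
      Tendsto (fun i => ∫ t, ⟪g t, w i t⟫) l (nhds 0))
    {g : ℝ → E3} (hg : Integrable g) :
    Tendsto (fun i => ∫ t, ⟪g t, w i t⟫) l (nhds 0) := by
  rw [Metric.tendsto_nhds]
  intro ε hε
  set M := |V| + 1
  have hM : 0 < M := by positivity
  obtain ⟨f, hfs, hfC, hf⟩ := MemLp.exist_eLpNorm_sub_le ENNReal.one_ne_top le_rfl
    (memLp_one_iff_integrable.2 hg) (ε := ε / (2 * M)) (by positivity)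
  have hfC1 : ContDiff ℝ 1 f := hfC.of_le (by exact_mod_cast le_top)
  have hfi : Integrable f := hfC1.continuous.integrable_of_hasCompactSupport hfs
  have hgfi : Integrable fun t => g t - f t := hg.sub hfi
  have hgf : ∫ t, ‖g t - f t‖ ≤ ε / (2 * M) := by
    rw [integral_norm_eq_lintegral_enorm hgfi.aestronglyMeasurable]
    rw [eLpNorm_one_eq_lintegral_enorm] at hf
    exact ENNReal.toReal_le_of_le_ofReal (by positivity) hf
  filter_upwards [hw, Metric.tendsto_nhds.1 (h f hfC1 hfs) (ε / 2) (half_pos hε)]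
    with i ⟨hc, hb⟩ hi
  have key : ∀ u : ℝ → E3, Integrable u → Integrable fun t => ⟪u t, w i t⟫ := fun u hu => by
    refine (hu.norm.mul_const V).mono' (hu.aestronglyMeasurable.inner hc.aestronglyMeasurable) ?_
    exact .of_forall fun t => (norm_inner_le_norm _ _).trans
      (mul_le_mul_of_nonneg_left (hb t) (norm_nonneg _))
  have hdiff : |∫ t, ⟪g t - f t, w i t⟫| ≤ ε / (2 * M) * M := by
    calc |∫ t, ⟪g t - f t, w i t⟫| ≤ ∫ t, ‖g t - f t‖ * M := by
          rw [← Real.norm_eq_abs]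
          refine norm_integral_le_of_norm_le (hgfi.norm.mul_const M)
            (.of_forall fun t => ?_)
          exact (norm_inner_le_norm _ _).trans (mul_le_mul_of_nonneg_left
            ((hb t).trans ((le_abs_self V).trans (le_add_of_nonneg_right zero_le_one)))
              (norm_nonneg _))
      _ ≤ ε / (2 * M) * M := by
          rw [integral_mul_const]
          exact mul_le_mul_of_nonneg_right hgf hM.le
  have hsplit : ∫ t, ⟪g t, w i t⟫ = (∫ t, ⟪g t - f t, w i t⟫) + ∫ t, ⟪f t, w i t⟫ := by
    rw [← integral_add (key _ hgfi) (key _ hfi)]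
    simp [← inner_add_left]
  rw [Real.dist_0_eq_abs] at hi ⊢
  have he : ε / (2 * M) * M = ε / 2 := by field_simp
  rw [hsplit]
  linarith [abs_add_le (∫ t, ⟪g t - f t, w i t⟫) (∫ t, ⟪f t, w i t⟫)]

/-- The perpendicular velocity is bounded by $|v_0|$ and converges weakly to $0$ in
$L^p_{loc}$ for every $1\le p<\infty$; in particular it vanishes when tested against
continuous compactly supported functions. -/
theorem stmt11 (B : E3 → E3) (hB : ContDiff ℝ 2 B) (hne : ∀ y : E3, B y ≠ 0)
    (hdiv : ∀ y : E3, divergence B y = 0) (x₀ v₀ : E3)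
    (b : E3 → E3) (hb : b = fun y => ‖B y‖⁻¹ • B y)
    (xω : ℝ → ℝ → E3)
    (hxC : ∀ ω > (0:ℝ), ContDiff ℝ 2 (xω ω))
    (hode : ∀ ω > (0:ℝ), ∀ t : ℝ,
      deriv (deriv (xω ω)) t = ω • cross (deriv (xω ω) t) (B (xω ω t)))
    (hinit : ∀ ω > (0:ℝ), xω ω 0 = x₀ ∧ deriv (xω ω) 0 = v₀)
    (vper : ℝ → ℝ → E3)
    (hvper : ∀ ω t, vper ω t =
      deriv (xω ω) t - ⟪deriv (xω ω) t, b (xω ω t)⟫ • b (xω ω t)) :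
    (∀ ω > (0:ℝ), ∀ t : ℝ, ‖vper ω t‖ ≤ ‖v₀‖) ∧
    (∀ p q : ENNReal, p.HolderConjugate q → 1 ≤ p → p ≠ ⊤ →
      ∀ g : ℝ → E3, HasCompactSupport g → MemLp g q MeasureTheory.volume →
        Tendsto (fun ω : ℝ => ∫ t : ℝ, ⟪g t, vper ω t⟫) atTop (nhds 0)) ∧
    (∀ g : ℝ → E3, Continuous g → HasCompactSupport g →
      Tendsto (fun ω : ℝ => ∫ t : ℝ, ⟪g t, vper ω t⟫) atTop (nhds 0)) := by
  have hd1 : ∀ ω > (0 : ℝ), ∀ t, HasDerivAt (xω ω) (deriv (xω ω) t) t := fun ω hω t =>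
    ((hxC ω hω).differentiable two_ne_zero t).hasDerivAt
  have hd2 : ∀ ω > (0 : ℝ), ∀ t,
      HasDerivAt (deriv (xω ω)) (ω • cross (deriv (xω ω) t) (B (xω ω t))) t := fun ω hω t => by
    rw [← hode ω hω t]
    exact ((hxC ω hω).differentiable_deriv_two t).hasDerivAt
  have hspeed : ∀ ω > (0 : ℝ), ∀ t, ‖deriv (xω ω) t‖ = ‖v₀‖ := fun ω hω t => by
    rw [← (hinit ω hω).2]
    exact HasDerivAt.norm_eq_of_inner_eq_zero (hd2 ω hω)
      (fun s => by rw [inner_smul_right, inner_self_cross, mul_zero]) t 0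
  have hb1 : ∀ y, ‖b y‖ = 1 := fun y => by
    rw [hb]
    exact norm_smul_inv_norm (𝕜 := ℝ) (hne y)
  have hbc : Continuous b := by
    rw [hb]
    exact (hB.continuous.norm.inv₀ fun y => by simpa using hne y).smul hB.continuous
  have hbound : ∀ ω > (0 : ℝ), ∀ t, ‖vper ω t‖ ≤ ‖v₀‖ := fun ω hω t => by
    rw [hvper, ← hspeed ω hω t]
    exact norm_sub_inner_smul_le (hb1 _) _
  have hcont : ∀ ω > (0 : ℝ), Continuous (vper ω) := fun ω hω => by
    rw [funext (hvper ω)]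
    have h1 : Continuous (xω ω) := (hxC ω hω).continuous
    have h2 : Continuous (deriv (xω ω)) := (hxC ω hω).continuous_deriv one_le_two
    fun_prop
  have hsmooth : ∀ g : ℝ → E3, ContDiff ℝ 1 g → HasCompactSupport g →
      Tendsto (fun ω => ∫ t, ⟪g t, vper ω t⟫) atTop (nhds 0) := fun g hg hgs => by
    obtain ⟨C, hC⟩ := exists_integral_inner_perp_le (hB.of_le one_le_two) hne x₀ ‖v₀‖ hg hgs
    refine squeeze_zero_norm' ?_ (tendsto_const_nhds.div_atTop tendsto_id : Tendsto
      (fun ω : ℝ => C / ω) atTop (nhds 0))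
    filter_upwards [eventually_gt_atTop 0] with ω hω
    simp only [hvper, hb]
    exact hC ω hω (xω ω) (deriv (xω ω)) (hinit ω hω).1 (fun t => (hspeed ω hω t).le)
      (hd1 ω hω) (hd2 ω hω)
  have hL1 : ∀ g : ℝ → E3, Integrable g →
      Tendsto (fun ω => ∫ t, ⟪g t, vper ω t⟫) atTop (nhds 0) := fun g hg =>
    tendsto_integral_inner_of_contDiff
      ((eventually_gt_atTop 0).mono fun ω hω => ⟨hcont ω hω, hbound ω hω⟩) hsmooth hg
  refine ⟨hbound, fun p q hpq _ _ g hgs hg => hL1 g ?_,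
    fun g hg hgs => hL1 g (hg.integrable_of_hasCompactSupport hgs)⟩
  exact memLp_one_iff_integrable.1 (hg.mono_exponent_of_measure_support_ne_top
    (fun t ht => image_eq_zero_of_notMem_tsupport ht) hgs.isCompact.measure_lt_top.ne
    hpq.symm.one_le)
end
end

section
/- Let B : ℝ³ → ℝ³ be a C¹ nowhere vanishing vector field and p : ℝ³ → ℝ a C¹ function satisfying B × curl B = ∇p. Set b := B/|B| and κ := ∇_b b. Then at every point the curvature drift across pressure surfaces satisfies (b × κ)·∇p = (B × ∇p)·∇(|B|⁻¹). -/
open MeasureTheory Filter RealInnerProductSpace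

noncomputable section

/-- Derivative of the reciprocal norm of a nonvanishing vector field. -/
lemma HasFDerivAt.inv_norm {E F : Type*} [NormedAddCommGroup E] [NormedSpace ℝ E]
    [NormedAddCommGroup F] [InnerProductSpace ℝ F] {B : E → F} {A : E →L[ℝ] F} {y : E}
    (hA : HasFDerivAt B A y) (hy : B y ≠ 0) :
    HasFDerivAt (fun z => ‖B z‖⁻¹) (-(‖B y‖⁻¹ ^ 3) • (innerSL ℝ (B y)).comp A) y := by
  have hn : ‖B y‖ ≠ 0 := norm_ne_zero_iff.mpr hy
  have hsqrt := hA.norm_sq.sqrt (pow_ne_zero 2 hn)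
  simp only [Real.sqrt_sq (norm_nonneg _)] at hsqrt
  refine ((hasDerivAt_inv hn).comp_hasFDerivAt y hsqrt).congr_fderiv ?_
  ext v
  simp
  field_simp

lemma gradient_apply_eq_fderiv_single (f : E3 → ℝ) (y : E3) (i : Fin 3) :
    gradient f y i = fderiv ℝ f y (EuclideanSpace.single i 1) := by
  have h : ⟪gradient f y, EuclideanSpace.single i (1 : ℝ)⟫ =
      fderiv ℝ f y (EuclideanSpace.single i 1) := by
    rw [gradient, InnerProductSpace.toDual_symm_apply]
  rw [← h, EuclideanSpace.inner_single_right]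
  simp

lemma fderiv_eq_sum_pd (f : E3 → E3) (y v : E3) :
    fderiv ℝ f y v = ∑ i, v i • pd f i y := by
  have hv : v = ∑ i, v i • EuclideanSpace.single i (1 : ℝ) := by
    ext j
    fin_cases j <;> simp [Fin.sum_univ_three]
  conv_lhs => rw [hv]
  simp [map_sum, pd]

/-- For an MHD equilibrium, the curvature drift across pressure surfaces satisfies
$(b\times\kappa)\cdot\nabla p = (B\times\nabla p)\cdot\nabla(|B|^{-1})$. -/
theorem stmt14 (B : E3 → E3) (hB : ContDiff ℝ 1 B) (hne : ∀ y : E3, B y ≠ 0)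
    (p : E3 → ℝ) (hp : ContDiff ℝ 1 p)
    (heq : ∀ y : E3, cross (B y) (curl B y) = gradient p y)
    (b : E3 → E3) (hb : b = fun y => ‖B y‖⁻¹ • B y)
    (κ : E3 → E3) (hκ : κ = fun y => fderiv ℝ b y (b y)) (y : E3) :
    ⟪cross (b y) (κ y), gradient p y⟫ =
      ⟪cross (B y) (gradient p y), gradient (fun z => ‖B z‖⁻¹) y⟫ := by
  have hA : HasFDerivAt B (fderiv ℝ B y) y :=
    (hB.differentiable one_ne_zero y).hasFDerivAt
  have hn := hA.inv_norm (hne y)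
  have hgrad (i : Fin 3) : gradient (fun z => ‖B z‖⁻¹) y i =
      -(‖B y‖⁻¹ ^ 3) * ⟪B y, pd B i y⟫ := by
    rw [gradient_apply_eq_fderiv_single, hn.fderiv]
    simp [pd]
  obtain ⟨c, hc⟩ : ∃ c : ℝ,
      κ y = ‖B y‖⁻¹ ^ 2 • (∑ i, B y i • pd B i y) + c • B y := by
    refine ⟨-(‖B y‖⁻¹ ^ 3) * ⟪B y, fderiv ℝ B y (‖B y‖⁻¹ • B y)⟫, ?_⟩
    rw [hκ, hb, ← fderiv_eq_sum_pd]
    simp only [(hn.fun_smul hA).fderiv]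
    simp [smul_smul, pow_two, real_inner_smul_right, mul_left_comm]
  have hby : b y = ‖B y‖⁻¹ • B y := by rw [hb]
  rw [← heq y, hc, hby]
  generalize ‖B y‖⁻¹ = n at *
  simp only [PiLp.inner_apply, Fin.sum_univ_three, hgrad]
  simp [cross, curl]
  ring
end
end
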